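/- Let r > 0, θ ∈ ℝ, σ > 0, and let h : ℝ → ℝ be Lipschitz with constant L ≥ 0. Let f_h be the solution of the VG(r,θ,σ,0) Stein equation with test function h. Then for every x ≠ 0 and every d ∈ ℝ such that f_h has derivative d at x, |d| ≤ (√(θ²+σ²)/σ²)·C(r,θ,σ)·L. -/

import Mathlib

open MeasureTheory Real Filter

/-- Modified Bessel function of the second kind. -/
noncomputable def besselK (ν x : ℝ) : ℝ :=
  ∫ t in Set.Ioi (0:ℝ), Real.exp (-x * Real.cosh t) * Real.cosh (ν * t)

/-- Modified Bessel function of the first kind. -/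
noncomputable def besselI (ν x : ℝ) : ℝ :=
  ∑' k : ℕ, (x / 2) ^ (ν + 2 * (k : ℝ)) / (Real.Gamma (ν + (k : ℝ) + 1) * (Nat.factorial k))

/-- The VG(r,θ,σ,0) density. -/
noncomputable def vgDensity (r θ σ x : ℝ) : ℝ :=
  (σ * Real.sqrt Real.pi * Real.Gamma (r / 2))⁻¹ * Real.exp (θ * x / σ ^ 2) *
    (|x| / (2 * Real.sqrt (θ ^ 2 + σ ^ 2))) ^ ((r - 1) / 2) *
    besselK ((r - 1) / 2) (Real.sqrt (θ ^ 2 + σ ^ 2) * |x| / σ ^ 2)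

/-- The centred test function h̃(x) = h(x) − E h(Z). -/
noncomputable def htilde (r θ σ : ℝ) (h : ℝ → ℝ) (x : ℝ) : ℝ :=
  h x - ∫ t, h t * vgDensity r θ σ t

/-- The solution of the VG(r,θ,σ,0) Stein equation with test function h. -/
noncomputable def steinSolution (r θ σ : ℝ) (h : ℝ → ℝ) (x : ℝ) : ℝ :=
  -(Real.exp (-(θ / σ ^ 2) * x) *
      besselK ((r - 1) / 2) (Real.sqrt (θ ^ 2 + σ ^ 2) / σ ^ 2 * |x|) /
      (σ ^ 2 * |x| ^ ((r - 1) / 2))) *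
    (∫ t in (0:ℝ)..x, Real.exp ((θ / σ ^ 2) * t) * |t| ^ ((r - 1) / 2) *
      besselI ((r - 1) / 2) (Real.sqrt (θ ^ 2 + σ ^ 2) / σ ^ 2 * |t|) * htilde r θ σ h t) -
  (Real.exp (-(θ / σ ^ 2) * x) *
      besselI ((r - 1) / 2) (Real.sqrt (θ ^ 2 + σ ^ 2) / σ ^ 2 * |x|) /
      (σ ^ 2 * |x| ^ ((r - 1) / 2))) *
    (∫ t in Set.Ioi x, Real.exp ((θ / σ ^ 2) * t) * |t| ^ ((r - 1) / 2) *
      besselK ((r - 1) / 2) (Real.sqrt (θ ^ 2 + σ ^ 2) / σ ^ 2 * |t|) * htilde r θ σ h t)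

/-- The constant A(r,θ,σ). -/
noncomputable def Aconst (r θ σ : ℝ) : ℝ :=
  if 2 ≤ r then 2 * Real.sqrt Real.pi / Real.sqrt (2 * r - 1) * (1 + θ ^ 2 / σ ^ 2) ^ (r / 2)
  else 12 * Real.Gamma (r / 2) * (1 + θ ^ 2 / σ ^ 2)

/-- The constant B(r,θ,σ). -/
noncomputable def Bconst (r θ σ : ℝ) : ℝ :=
  if 2 ≤ r then Real.sqrt (Real.pi * (r - 1) / 2) * (1 + θ ^ 2 / σ ^ 2) ^ (r / 2 - 1)
  else 2

/-- The constant C(r,θ,σ). -/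
noncomputable def Cconst (r θ σ : ℝ) : ℝ :=
  6 + 2 * Real.sqrt 2 / Real.sqrt r +
    2 * Real.sqrt (2 * Real.pi * (r + 1)) * (|θ| / σ) * (1 + θ ^ 2 / σ ^ 2) ^ ((r - 1) / 2) +
    2 * (Real.sqrt (2 * r) + r) * Aconst r θ σ



/-- An abstract system of functions with the properties of
`k0 = y^ν K_ν`, `k1 = y^(ν+1) K_(ν+1)`, `i0 = y^(-ν) I_ν`, `i1 = y^(-ν-1) I_(ν+1)`, `r = 2ν+1`. -/
structure BSys (r : ℝ) (k0 k1 i0 i1 : ℝ → ℝ) (c S : ℝ) : Prop where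
  hr : 0 < r
  hc : 0 < c
  i0_zero : i0 0 = c
  k0_pos : ∀ y, 0 < y → 0 < k0 y
  k1_pos : ∀ y, 0 < y → 0 < k1 y
  i0_pos : ∀ y, 0 < y → 0 < i0 y
  i1_pos : ∀ y, 0 < y → 0 < i1 y
  dk0 : ∀ y, 0 < y → HasDerivAt k0 (((r - 1) * k0 y - k1 y) / y) y
  dk1 : ∀ y, 0 < y → HasDerivAt k1 (-(y * k0 y)) y
  di0 : ∀ y, HasDerivAt i0 (y * i1 y) y
  di1 : ∀ y, 0 < y → HasDerivAt i1 ((i0 y - (r + 1) * i1 y) / y) y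
  ci1 : Continuous i1
  kle : ∀ y, 0 < y → y * k0 y ≤ k1 y
  kge : ∀ y, 0 < y → (r - 1) * k0 y ≤ k1 y
  k1lim : Tendsto k1 (nhdsWithin 0 (Set.Ioi 0)) (nhds c⁻¹)
  decay : ∃ D : ℝ, ∀ y, 1 ≤ y → k1 y ≤ D * (y ^ ((r + 1) / 2) * Real.exp (-y))
  int0 : ∀ b : ℝ, |b| < 1 → IntegrableOn (fun t => Real.exp (b * t) * k0 t) (Set.Ioi 0)
  int1 : ∀ b : ℝ, |b| < 1 → IntegrableOn (fun t => Real.exp (b * t) * k1 t) (Set.Ioi 0)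
  tot0 : ∀ b : ℝ, |b| < 1 →
    c * (∫ t in Set.Ioi (0:ℝ), Real.exp (b * t) * k0 t) ≤ S * (1 - b ^ 2) ^ (-(r / 2))
  tot1 : ∀ b : ℝ, |b| < 1 →
    c * (∫ t in Set.Ioi (0:ℝ), Real.exp (b * t) * k1 t) ≤ S * r * (1 - b ^ 2) ^ (-(r / 2) - 1)
  half0 : c * (∫ t in Set.Ioi (0:ℝ), k0 t) ≤ S / 2
  Sle : S ≤ Real.sqrt (2 * Real.pi * (r + 1)) / r

lemma mono_Ioi_aux {f f' : ℝ → ℝ} (hd : ∀ y, 0 < y → HasDerivAt f (f' y) y)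
    (hn : ∀ y, 0 < y → 0 ≤ f' y) : MonotoneOn f (Set.Ioi 0) := by
  apply monotoneOn_of_deriv_nonneg (convex_Ioi 0)
  · exact fun y hy => (hd y hy).continuousAt.continuousWithinAt
  · rw [interior_Ioi]
    exact fun y hy => (hd y hy).differentiableAt.differentiableWithinAt
  · rw [interior_Ioi]
    intro y hy
    rw [(hd y hy).deriv]
    exact hn y hy

namespace BSys

variable {r c S : ℝ} {k0 k1 i0 i1 : ℝ → ℝ}

lemma ci0 (B : BSys r k0 k1 i0 i1 c S) : Continuous i0 :=
  continuous_iff_continuousAt.2 fun y => (B.di0 y).continuousAt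

lemma wron (B : BSys r k0 k1 i0 i1 c S) {y : ℝ} (hy : 0 < y) :
    i0 y * k1 y + y ^ 2 * i1 y * k0 y = 1 := by
  set f : ℝ → ℝ := fun y => i0 y * k1 y + y ^ 2 * i1 y * k0 y with hf
  have hd : ∀ y, 0 < y → HasDerivAt f 0 y := by
    intro y hy
    have h := ((B.di0 y).mul (B.dk1 y hy)).add
      ((((hasDerivAt_pow 2 y)).mul (B.di1 y hy)).mul (B.dk0 y hy))
    refine h.congr_deriv ?_
    simp only [Pi.mul_apply]
    field_simp
    push_cast
    ring
  have hconst : ∀ x, 0 < x → f x = f y := by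
    intro x hx
    refine isOpen_Ioi.is_const_of_deriv_eq_zero (s := Set.Ioi (0:ℝ)) (convex_Ioi 0).isPreconnected
      (fun z hz => (hd z hz).differentiableAt.differentiableWithinAt)
      (fun z hz => (hd z hz).deriv) hx hy
  have hlim : Tendsto f (nhdsWithin 0 (Set.Ioi 0)) (nhds 1) := by
    have hid : Tendsto (fun y : ℝ => y) (nhdsWithin 0 (Set.Ioi 0)) (nhds 0) :=
      tendsto_nhdsWithin_of_tendsto_nhds tendsto_id
    have hi0 : Tendsto i0 (nhdsWithin 0 (Set.Ioi 0)) (nhds c) := by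
      have := (B.ci0.tendsto 0).mono_left (nhdsWithin_le_nhds (s := Set.Ioi (0:ℝ)))
      rwa [B.i0_zero] at this
    have hi1 : Tendsto i1 (nhdsWithin 0 (Set.Ioi 0)) (nhds (i1 0)) :=
      (B.ci1.tendsto 0).mono_left (nhdsWithin_le_nhds (s := Set.Ioi (0:ℝ)))
    have h1 := hi0.mul B.k1lim
    rw [mul_inv_cancel₀ B.hc.ne'] at h1
    have h2 : Tendsto (fun y => y ^ 2 * i1 y * k0 y) (nhdsWithin 0 (Set.Ioi 0)) (nhds 0) := by
      have h3 : Tendsto (fun y => y * i1 y * k1 y) (nhdsWithin 0 (Set.Ioi 0)) (nhds 0) := by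
        have := (hid.mul hi1).mul B.k1lim
        simpa using this
      refine squeeze_zero' ?_ ?_ h3
      · filter_upwards [self_mem_nhdsWithin] with z hz
        have hz' : 0 < z := hz
        have := B.k0_pos z hz
        have := B.i1_pos z hz
        positivity
      · filter_upwards [self_mem_nhdsWithin] with z hz
        have hz' : 0 < z := hz
        have h4 := B.kle z hz
        have h5 := B.i1_pos z hz
        have : 0 ≤ z * i1 z := by positivity
        nlinarith [mul_le_mul_of_nonneg_left h4 this]
    simpa using h1.add h2
  have hlim2 : Tendsto f (nhdsWithin 0 (Set.Ioi 0)) (nhds (f y)) := by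
    refine tendsto_const_nhds.congr' ?_
    filter_upwards [self_mem_nhdsWithin] with z hz
    exact (hconst z hz).symm
  exact tendsto_nhds_unique hlim2 hlim

lemma i0k1_le (B : BSys r k0 k1 i0 i1 c S) {y : ℝ} (hy : 0 < y) : i0 y * k1 y ≤ 1 := by
  have := B.wron hy
  have := B.k0_pos y hy
  have := B.i1_pos y hy
  have : 0 ≤ y ^ 2 * i1 y * k0 y := by positivity
  linarith

lemma iE (B : BSys r k0 k1 i0 i1 c S) {y : ℝ} (hy : 0 < y) :
    y ^ 2 * i1 y ^ 2 + r * i0 y * i1 y ≤ i0 y ^ 2 := by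
  set g : ℝ → ℝ := fun y => y ^ r * (i0 y ^ 2 - y ^ 2 * i1 y ^ 2 - r * i0 y * i1 y) with hg
  have hd : ∀ y, 0 < y → HasDerivAt g (r / y * y ^ r * (i0 y * i1 y)) y := by
    intro y hy
    have h := (Real.hasDerivAt_rpow_const (p := r) (Or.inl hy.ne')).mul
      ((((B.di0 y).pow 2).sub ((hasDerivAt_pow 2 y).mul ((B.di1 y hy).pow 2))).sub
        (((B.di0 y).const_mul r).mul (B.di1 y hy)))
    refine h.congr_deriv ?_
    have : y ^ r = y ^ (r - 1) * y := by
      rw [← Real.rpow_add_one hy.ne']; ring_nf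
    simp only [Pi.mul_apply, Pi.sub_apply, Pi.pow_apply]
    rw [this]
    field_simp
    push_cast
    ring
  have hm : MonotoneOn g (Set.Ioi 0) := mono_Ioi_aux hd (by
    intro z hz
    have := B.hr
    have := B.i0_pos z hz
    have := B.i1_pos z hz
    have := Real.rpow_pos_of_pos hz r
    positivity)
  have hlim : Tendsto g (nhdsWithin 0 (Set.Ioi 0)) (nhds 0) := by
    have hcont : Continuous g := by
      have h0 := B.ci0
      have h1 := B.ci1
      have h2 := Real.continuous_rpow_const B.hr.le
      fun_prop
    have := (hcont.tendsto 0).mono_left (nhdsWithin_le_nhds (s := Set.Ioi (0:ℝ)))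
    simpa [hg, Real.zero_rpow B.hr.ne'] using this
  have hge : 0 ≤ g y := by
    refine le_of_tendsto hlim ?_
    filter_upwards [Ioo_mem_nhdsGT hy] with z hz
    exact hm hz.1 hy hz.2.le
  have h1 := Real.rpow_pos_of_pos hy r
  have h2 := nonneg_of_mul_nonneg_right hge h1
  linarith

lemma ile (B : BSys r k0 k1 i0 i1 c S) {y : ℝ} (hy : 0 < y) : y * i1 y ≤ i0 y := by
  have h := B.iE hy
  have h1 := B.i0_pos y hy
  have h2 := B.i1_pos y hy
  have : 0 ≤ r * i0 y * i1 y := by have := B.hr; positivity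
  refine abs_le_of_sq_le_sq' (a := y * i1 y) ?_ h1.le |>.2
  nlinarith

lemma exp_k1_tendsto (B : BSys r k0 k1 i0 i1 c S) {b : ℝ} (hb : b < 1) :
    Tendsto (fun y => Real.exp (b * y) * k1 y) atTop (nhds 0) := by
  obtain ⟨D, hD⟩ := B.decay
  have h := (tendsto_rpow_mul_exp_neg_mul_atTop_nhds_zero ((r + 1) / 2) (1 - b)
    (by linarith)).const_mul D
  rw [mul_zero] at h
  refine squeeze_zero' ?_ ?_ h
  · filter_upwards [eventually_gt_atTop 0] with y hy
    have := B.k1_pos y hy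
    positivity
  · filter_upwards [eventually_ge_atTop 1] with y hy
    have := mul_le_mul_of_nonneg_left (hD y hy) (Real.exp_pos (b * y)).le
    refine this.trans (le_of_eq ?_)
    rw [show -(1 - b) * y = b * y + -y by ring, Real.exp_add]
    ring

lemma kE (B : BSys r k0 k1 i0 i1 c S) {y : ℝ} (hy : 0 < y) :
    k1 y ^ 2 ≤ y ^ 2 * k0 y ^ 2 + r * k0 y * k1 y := by
  set g : ℝ → ℝ := fun y => y ^ (-r) * (k1 y ^ 2 - y ^ 2 * k0 y ^ 2 - r * k0 y * k1 y) with hg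
  have hd : ∀ y, 0 < y → HasDerivAt g (r / y * y ^ (-r) * (k0 y * k1 y)) y := by
    intro y hy
    have h := (Real.hasDerivAt_rpow_const (p := -r) (Or.inl hy.ne')).mul
      ((((B.dk1 y hy).pow 2).sub ((hasDerivAt_pow 2 y).mul ((B.dk0 y hy).pow 2))).sub
        (((B.dk0 y hy).const_mul r).mul (B.dk1 y hy)))
    refine h.congr_deriv ?_
    have : y ^ (-r) = y ^ (-r - 1) * y := by
      rw [← Real.rpow_add_one hy.ne']; ring_nf
    simp only [Pi.mul_apply, Pi.sub_apply, Pi.pow_apply]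
    rw [this]
    field_simp
    push_cast
    ring
  have hm : MonotoneOn g (Set.Ioi 0) := mono_Ioi_aux hd (by
    intro z hz
    have := B.hr
    have := B.k0_pos z hz
    have := B.k1_pos z hz
    have := Real.rpow_pos_of_pos hz (-r)
    positivity)
  have hk1 : Tendsto k1 atTop (nhds 0) := by
    have := B.exp_k1_tendsto (b := 0) (by norm_num)
    simpa using this
  have hle : g y ≤ 0 := by
    have h1 : Tendsto (fun z => k1 z ^ 2) atTop (nhds 0) := by
      simpa using hk1.pow 2
    refine ge_of_tendsto h1 ?_
    filter_upwards [eventually_ge_atTop y, eventually_ge_atTop 1] with z hz hz1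
    have hz0 : 0 < z := by linarith
    refine (hm hy hz0 hz).trans ?_
    have h2 := B.k0_pos z hz0
    have h3 := B.k1_pos z hz0
    have h4 : z ^ (-r) ≤ 1 := Real.rpow_le_one_of_one_le_of_nonpos hz1 (by linarith [B.hr])
    have h5 := Real.rpow_pos_of_pos hz0 (-r)
    have h6 : 0 ≤ r * k0 z * k1 z := by have := B.hr; positivity
    have h7 : 0 ≤ z ^ 2 * k0 z ^ 2 := by positivity
    calc g z ≤ z ^ (-r) * k1 z ^ 2 := mul_le_mul_of_nonneg_left (by linarith) h5.le
      _ ≤ 1 * k1 z ^ 2 := mul_le_mul_of_nonneg_right h4 (by positivity)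
      _ = k1 z ^ 2 := one_mul _
  have h1 := Real.rpow_pos_of_pos hy (-r)
  have h2 : k1 y ^ 2 - y ^ 2 * k0 y ^ 2 - r * k0 y * k1 y ≤ 0 := by
    by_contra hcon
    push Not at hcon
    have := mul_pos h1 hcon
    exact absurd hle (not_le.2 this)
  linarith

/-- the ratio `y i1 / i0` is monotone -/
lemma rho_mono (B : BSys r k0 k1 i0 i1 c S) :
    MonotoneOn (fun y => y * i1 y / i0 y) (Set.Ioi 0) := by
  refine mono_Ioi_aux (f' := fun y =>
    (i0 y ^ 2 - r * i0 y * i1 y - y ^ 2 * i1 y ^ 2) / i0 y ^ 2) ?_ ?_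
  · intro y hy
    have h0 := (B.i0_pos y hy).ne'
    have h := ((hasDerivAt_id y).mul (B.di1 y hy)).div (B.di0 y) h0
    refine h.congr_deriv ?_
    simp only [Pi.mul_apply, id]
    field_simp
    ring
  · intro y hy
    have := B.iE hy
    apply div_nonneg _ (by positivity)
    linarith

/-- the ratio `y k0 / k1` is monotone -/
lemma kappa_mono (B : BSys r k0 k1 i0 i1 c S) :
    MonotoneOn (fun y => y * k0 y / k1 y) (Set.Ioi 0) := by
  refine mono_Ioi_aux (f' := fun y =>
    (y ^ 2 * k0 y ^ 2 + r * k0 y * k1 y - k1 y ^ 2) / k1 y ^ 2) ?_ ?_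
  · intro y hy
    have h0 := (B.k1_pos y hy).ne'
    have h := ((hasDerivAt_id y).mul (B.dk0 y hy)).div (B.dk1 y hy) h0
    refine h.congr_deriv ?_
    simp only [Pi.mul_apply, id]
    field_simp
    ring
  · intro y hy
    have := B.kE hy
    apply div_nonneg _ (by positivity)
    linarith

lemma rho_le_kappa (B : BSys r k0 k1 i0 i1 c S) {y : ℝ} (hy : 0 < y) :
    y * i1 y / i0 y ≤ y * k0 y / k1 y := by
  have h1 := B.iE hy
  have h2 := B.kE hy
  have p0 := B.i0_pos y hy
  have p1 := B.i1_pos y hy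
  have q0 := B.k0_pos y hy
  have q1 := B.k1_pos y hy
  have hr := B.hr
  set ρ := y * i1 y / i0 y with hρ
  set κ := y * k0 y / k1 y with hκ
  have hρ0 : 0 < ρ := by positivity
  have hκ0 : 0 < κ := by positivity
  have e1 : ρ ^ 2 + r / y * ρ ≤ 1 := by
    have : ρ ^ 2 + r / y * ρ = (y ^ 2 * i1 y ^ 2 + r * i0 y * i1 y) / i0 y ^ 2 := by
      rw [hρ]; field_simp
    rw [this, div_le_one (by positivity)]
    exact h1
  have e2 : 1 ≤ κ ^ 2 + r / y * κ := by
    have : κ ^ 2 + r / y * κ = (y ^ 2 * k0 y ^ 2 + r * k0 y * k1 y) / k1 y ^ 2 := by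
      rw [hκ]; field_simp
    rw [this, one_le_div (by positivity)]
    exact h2
  by_contra hcon
  push Not at hcon
  have h3 : κ ^ 2 < ρ ^ 2 := by nlinarith
  have h4 : r / y * κ < r / y * ρ := mul_lt_mul_of_pos_left hcon (by positivity)
  linarith

end BSys


namespace BSys

variable {r c S : ℝ} {k0 k1 i0 i1 : ℝ → ℝ}

lemma ck0 (B : BSys r k0 k1 i0 i1 c S) : ContinuousOn k0 (Set.Ioi 0) :=
  fun y hy => (B.dk0 y hy).continuousAt.continuousWithinAt

lemma ck1 (B : BSys r k0 k1 i0 i1 c S) : ContinuousOn k1 (Set.Ioi 0) :=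
  fun y hy => (B.dk1 y hy).continuousAt.continuousWithinAt

lemma intT (B : BSys r k0 k1 i0 i1 c S) {b : ℝ} (hb : |b| < 1) :
    IntegrableOn (fun t => Real.exp (b * t) * (t * k0 t)) (Set.Ioi 0) := by
  refine Integrable.mono' (B.int1 b hb) ?_ ?_
  · have h := B.ck0
    have : ContinuousOn (fun t => Real.exp (b * t) * (t * k0 t)) (Set.Ioi 0) := by fun_prop
    exact this.aestronglyMeasurable measurableSet_Ioi
  · filter_upwards [ae_restrict_mem measurableSet_Ioi] with t ht
    have ht' : 0 < t := ht
    have h0 := B.k0_pos t ht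
    rw [Real.norm_of_nonneg (by positivity)]
    exact mul_le_mul_of_nonneg_left (B.kle t ht) (Real.exp_pos _).le

lemma K2_gen (B : BSys r k0 k1 i0 i1 c S) {b y l : ℝ} (hb : |b| < 1) (hy : 0 ≤ y)
    (hl : Tendsto k1 (nhdsWithin y (Set.Ioi y)) (nhds l)) :
    ∫ t in Set.Ioi y, Real.exp (b * t) * (t * k0 t) =
      Real.exp (b * y) * l + b * ∫ t in Set.Ioi y, Real.exp (b * t) * k1 t := by
  have hsub : Set.Ioi y ⊆ Set.Ioi 0 := Set.Ioi_subset_Ioi hy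
  have i1' := (B.int1 b hb).mono_set hsub
  have i2' := (B.intT hb).mono_set hsub
  have hde : ∀ x : ℝ, HasDerivAt (fun t => Real.exp (b * t)) (b * Real.exp (b * x)) x := by
    intro x
    have := ((hasDerivAt_id x).const_mul b).exp
    refine this.congr_deriv ?_
    simp [mul_comm]
  have key := integral_Ioi_deriv_mul_eq_sub (a := y) (a' := Real.exp (b * y) * l) (b' := 0)
    (u := fun t => Real.exp (b * t)) (v := k1) (u' := fun t => b * Real.exp (b * t))
    (v' := fun t => -(t * k0 t)) (fun x _ => hde x)
    (fun x hx => B.dk1 x (hsub hx)) ?_ ?_ ?_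
  · have h1 : ∫ t in Set.Ioi y, (b * Real.exp (b * t) * k1 t + Real.exp (b * t) * -(t * k0 t)) =
        b * (∫ t in Set.Ioi y, Real.exp (b * t) * k1 t) -
          ∫ t in Set.Ioi y, Real.exp (b * t) * (t * k0 t) := by
      rw [← integral_const_mul, ← integral_sub (i1'.const_mul b) i2']
      congr 1; ext t; ring
    rw [h1] at key
    linarith
  · have := (i1'.const_mul b).sub i2'
    refine this.congr (Eventually.of_forall fun t => ?_)
    simp only [Pi.sub_apply, Pi.add_apply, Pi.mul_apply]; ring
  · have : Tendsto (fun t => Real.exp (b * t)) (nhdsWithin y (Set.Ioi y))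
        (nhds (Real.exp (b * y))) := (hde y).continuousAt.tendsto.mono_left nhdsWithin_le_nhds
    exact this.mul hl
  · exact B.exp_k1_tendsto (lt_of_abs_lt hb)

lemma K2_eq (B : BSys r k0 k1 i0 i1 c S) {b y : ℝ} (hb : |b| < 1) (hy : 0 < y) :
    ∫ t in Set.Ioi y, Real.exp (b * t) * (t * k0 t) =
      Real.exp (b * y) * k1 y + b * ∫ t in Set.Ioi y, Real.exp (b * t) * k1 t :=
  B.K2_gen hb hy.le ((B.dk1 y hy).continuousAt.tendsto.mono_left nhdsWithin_le_nhds)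

lemma K2_zero (B : BSys r k0 k1 i0 i1 c S) {b : ℝ} (hb : |b| < 1) :
    ∫ t in Set.Ioi 0, Real.exp (b * t) * (t * k0 t) =
      c⁻¹ + b * ∫ t in Set.Ioi 0, Real.exp (b * t) * k1 t := by
  simpa using B.K2_gen hb le_rfl B.k1lim

lemma K_nonneg0 (B : BSys r k0 k1 i0 i1 c S) {b y : ℝ} (hy : 0 ≤ y) :
    0 ≤ ∫ t in Set.Ioi y, Real.exp (b * t) * k0 t :=
  setIntegral_nonneg measurableSet_Ioi fun t ht =>
    mul_nonneg (Real.exp_pos _).le (B.k0_pos t (lt_of_le_of_lt hy ht)).le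

lemma K_nonneg1 (B : BSys r k0 k1 i0 i1 c S) {b y : ℝ} (hy : 0 ≤ y) :
    0 ≤ ∫ t in Set.Ioi y, Real.exp (b * t) * k1 t :=
  setIntegral_nonneg measurableSet_Ioi fun t ht =>
    mul_nonneg (Real.exp_pos _).le (B.k1_pos t (lt_of_le_of_lt hy ht)).le

lemma K_nonnegT (B : BSys r k0 k1 i0 i1 c S) {b y : ℝ} (hy : 0 ≤ y) :
    0 ≤ ∫ t in Set.Ioi y, Real.exp (b * t) * (t * k0 t) :=
  setIntegral_nonneg measurableSet_Ioi fun t ht =>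
    mul_nonneg (Real.exp_pos _).le (mul_nonneg (hy.trans (le_of_lt ht))
      (B.k0_pos t (lt_of_le_of_lt hy ht)).le)

/-- derivative of `exp(-b y) i0(y)` -/
noncomputable def Qd (i0 i1 : ℝ → ℝ) (b y : ℝ) : ℝ := Real.exp (-b * y) * (y * i1 y - b * i0 y)

/-- minus the derivative of `exp(-b y) y^(1-r) k0(y)` -/
noncomputable def Pd (r : ℝ) (k0 k1 : ℝ → ℝ) (b y : ℝ) : ℝ :=
  Real.exp (-b * y) * y ^ (-r) * (k1 y + b * (y * k0 y))

lemma Qd_mono (B : BSys r k0 k1 i0 i1 c S) (b : ℝ) : MonotoneOn (Qd i0 i1 b) (Set.Ioi 0) := by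
  refine mono_Ioi_aux (f' := fun y => Real.exp (-b * y) *
    ((1 + b ^ 2) * i0 y - 2 * b * y * i1 y - r * i1 y)) ?_ ?_
  · intro y hy
    have hde : HasDerivAt (fun t => Real.exp (-b * t)) (-b * Real.exp (-b * y)) y := by
      have := ((hasDerivAt_id y).const_mul (-b)).exp
      refine this.congr_deriv ?_
      simp [mul_comm]
    have h := hde.mul (((hasDerivAt_id y).mul (B.di1 y hy)).sub ((B.di0 y).const_mul b))
    refine h.congr_deriv ?_
    simp only [Pi.mul_apply, id, Pi.sub_apply]
    field_simp
    ring
  · intro y hy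
    refine mul_nonneg (Real.exp_pos _).le ?_
    have h0 := B.i0_pos y hy
    have h := B.iE hy
    refine nonneg_of_mul_nonneg_right (?_ : 0 ≤ i0 y * _) h0
    nlinarith [sq_nonneg (y * i1 y - b * i0 y)]

lemma Qd_ge (B : BSys r k0 k1 i0 i1 c S) (b : ℝ) {y : ℝ} (hy : 0 < y) :
    -(b * c) ≤ Qd i0 i1 b y := by
  have hcont : Continuous (Qd i0 i1 b) := by
    have h0 := B.ci0
    have h1 := B.ci1
    unfold Qd
    fun_prop
  have h := (hcont.tendsto 0).mono_left (nhdsWithin_le_nhds (s := Set.Ioi (0:ℝ)))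
  have h0 : Qd i0 i1 b 0 = -(b * c) := by simp [Qd, B.i0_zero]
  rw [h0] at h
  refine le_of_tendsto h ?_
  filter_upwards [Ioo_mem_nhdsGT hy] with z hz
  exact B.Qd_mono b hz.1 hy hz.2.le

lemma Qd_le (B : BSys r k0 k1 i0 i1 c S) (b : ℝ) {y : ℝ} (hy : 0 < y) :
    Qd i0 i1 b y ≤ (1 + |b|) * (Real.exp (-b * y) * i0 y) := by
  have h1 := B.ile hy
  have h0 := B.i0_pos y hy
  have h2 : -(b * i0 y) ≤ |b| * i0 y := by
    rw [← neg_mul]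
    exact mul_le_mul_of_nonneg_right (neg_le_abs b) h0.le
  have h3 : y * i1 y - b * i0 y ≤ (1 + |b|) * i0 y := by linarith
  have := mul_le_mul_of_nonneg_left h3 (Real.exp_pos (-b * y)).le
  unfold Qd
  linarith

lemma i0_le_exp (B : BSys r k0 k1 i0 i1 c S) {y : ℝ} (hy : 0 < y) :
    i0 y ≤ c * Real.exp y := by
  have hcont : Continuous (fun t => -(Real.exp (-t) * i0 t)) := by
    have h0 := B.ci0
    fun_prop
  have hm : MonotoneOn (fun t => -(Real.exp (-t) * i0 t)) (Set.Ioi 0) := by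
    refine mono_Ioi_aux (f' := fun y => Real.exp (-y) * (i0 y - y * i1 y)) ?_ ?_
    · intro y hy
      have h := (((hasDerivAt_id y).neg.exp).mul (B.di0 y)).neg
      refine h.congr_deriv ?_
      simp only [Pi.neg_apply, id]
      ring
    · intro y hy
      exact mul_nonneg (Real.exp_pos _).le (by linarith [B.ile hy])
  have h := (hcont.tendsto 0).mono_left (nhdsWithin_le_nhds (s := Set.Ioi (0:ℝ)))
  simp only [neg_zero, Real.exp_zero, one_mul, B.i0_zero] at h
  have h2 : -c ≤ -(Real.exp (-y) * i0 y) := by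
    refine le_of_tendsto h ?_
    filter_upwards [Ioo_mem_nhdsGT hy] with z hz
    exact hm hz.1 hy hz.2.le
  have h3 : Real.exp (-y) * i0 y ≤ c := by linarith
  rw [Real.exp_neg, inv_mul_le_iff₀ (Real.exp_pos y)] at h3
  linarith

/-! ### The integrals over `(0,y)` -/

lemma intI1 (B : BSys r k0 k1 i0 i1 c S) (b y : ℝ) :
    IntervalIntegrable (fun t => Real.exp (b * t) * t ^ (r - 1) * i0 t) volume 0 y := by
  have h := (intervalIntegral.intervalIntegrable_rpow' (a := 0) (b := y) (r := r - 1)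
    (by linarith [B.hr])).mul_continuousOn (g := fun t => Real.exp (b * t) * i0 t)
      (by have := B.ci0; fun_prop)
  refine h.congr (fun t _ => ?_)
  ring

lemma intI2 (B : BSys r k0 k1 i0 i1 c S) (b y : ℝ) :
    IntervalIntegrable (fun t => Real.exp (b * t) * t ^ r * i0 t) volume 0 y := by
  refine Continuous.intervalIntegrable ?_ _ _
  have := B.ci0
  have := Real.continuous_rpow_const B.hr.le
  fun_prop

lemma I1_le (B : BSys r k0 k1 i0 i1 c S) {b y : ℝ} (hb : |b| < 1) (hy : 0 < y) :
    ∫ t in (0:ℝ)..y, Real.exp (b * t) * t ^ (r - 1) * i0 t ≤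
      Real.exp (b * y) * y ^ r * (i0 y - b * (y * i1 y)) / r := by
  have hr := B.hr
  have key := intervalIntegral.integral_le_sub_of_hasDeriv_right_of_le
    (g := fun t => Real.exp (b * t) * t ^ r * (i0 t - b * (t * i1 t)))
    (g' := fun t => Real.exp (b * t) * (r * (t ^ (r - 1) * i0 t) +
      (1 - b ^ 2) * (t ^ (r - 1) * t ^ 2 * i1 t)))
    (φ := fun t => r * (Real.exp (b * t) * t ^ (r - 1) * i0 t)) hy.le ?_ ?_ ?_ ?_
  · rw [intervalIntegral.integral_const_mul] at key
    simp only [mul_zero, Real.zero_rpow hr.ne', zero_mul, sub_zero] at key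
    rw [le_div_iff₀ hr]
    linarith
  · have := B.ci0
    have := B.ci1
    have := Real.continuous_rpow_const B.hr.le
    fun_prop
  · intro t ht
    have ht0 : 0 < t := ht.1
    have hde : HasDerivAt (fun t => Real.exp (b * t)) (b * Real.exp (b * t)) t := by
      have := ((hasDerivAt_id t).const_mul b).exp
      refine this.congr_deriv ?_
      simp [mul_comm]
    have h := (hde.mul (Real.hasDerivAt_rpow_const (p := r) (Or.inl ht0.ne'))).mul
      ((B.di0 t).sub (((hasDerivAt_id t).mul (B.di1 t ht0)).const_mul b))
    refine (h.congr_deriv ?_).hasDerivWithinAt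
    have : t ^ r = t ^ (r - 1) * t := by
      rw [← Real.rpow_add_one ht0.ne']; ring_nf
    simp only [Pi.mul_apply, id, Pi.sub_apply]
    rw [this]
    field_simp
    ring
  · exact (((B.intI1 b y).const_mul r).1).congr_set_ae Ioc_ae_eq_Icc.symm
  · intro t ht
    have ht0 : 0 < t := ht.1
    have h1 : 0 ≤ (1 - b ^ 2) * (t ^ (r - 1) * t ^ 2 * i1 t) := by
      have := B.i1_pos t ht0
      have := Real.rpow_pos_of_pos ht0 (r - 1)
      have h2 : 0 ≤ 1 - b ^ 2 := by
        have := (sq_lt_one_iff_abs_lt_one b).2 hb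
        linarith
      positivity
    have := mul_nonneg (Real.exp_pos (b * t)).le h1
    linarith

lemma I2_le (B : BSys r k0 k1 i0 i1 c S) {b m y : ℝ} (hmb : m ≤ b) (hm0 : m ≤ 0) (hm : -1 < m)
    (hy : 0 < y) :
    (1 + m) * ∫ t in (0:ℝ)..y, Real.exp (b * t) * t ^ r * i0 t ≤
      Real.exp (b * y) * y ^ r * (y * i1 y) := by
  have hr := B.hr
  have key := intervalIntegral.integral_le_sub_of_hasDeriv_right_of_le
    (g := fun t => Real.exp (b * t) * t ^ r * (t * i1 t))
    (g' := fun t => Real.exp (b * t) * t ^ r * (i0 t + b * (t * i1 t)))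
    (φ := fun t => (1 + m) * (Real.exp (b * t) * t ^ r * i0 t)) hy.le ?_ ?_ ?_ ?_
  · rw [intervalIntegral.integral_const_mul] at key
    simp only [zero_mul, mul_zero, sub_zero] at key
    linarith
  · have := B.ci0
    have := B.ci1
    have := Real.continuous_rpow_const B.hr.le
    fun_prop
  · intro t ht
    have ht0 : 0 < t := ht.1
    have hde : HasDerivAt (fun t => Real.exp (b * t)) (b * Real.exp (b * t)) t := by
      have := ((hasDerivAt_id t).const_mul b).exp
      refine this.congr_deriv ?_
      simp [mul_comm]
    have h := (hde.mul (Real.hasDerivAt_rpow_const (p := r) (Or.inl ht0.ne'))).mul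
      ((hasDerivAt_id t).mul (B.di1 t ht0))
    refine (h.congr_deriv ?_).hasDerivWithinAt
    have : t ^ r = t ^ (r - 1) * t := by
      rw [← Real.rpow_add_one ht0.ne']; ring_nf
    simp only [Pi.mul_apply, id]
    rw [this]
    field_simp
    ring
  · exact (((B.intI2 b y).const_mul (1 + m)).1).congr_set_ae Ioc_ae_eq_Icc.symm
  · intro t ht
    have ht0 : 0 < t := ht.1
    have h1 := B.i1_pos t ht0
    have h2 := B.ile ht0
    have h3 : m * i0 t ≤ b * (t * i1 t) := by
      have e1 : m * i0 t ≤ m * (t * i1 t) := mul_le_mul_of_nonpos_left h2 hm0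
      have e2 : m * (t * i1 t) ≤ b * (t * i1 t) := mul_le_mul_of_nonneg_right hmb (by positivity)
      linarith
    have h4 : 0 < Real.exp (b * t) * t ^ r :=
      mul_pos (Real.exp_pos _) (Real.rpow_pos_of_pos ht0 r)
    have := mul_le_mul_of_nonneg_left h3 h4.le
    linarith

lemma Pd_nonneg (B : BSys r k0 k1 i0 i1 c S) {b y : ℝ} (hb : |b| < 1) (hy : 0 < y) :
    0 ≤ k1 y + b * (y * k0 y) := by
  have h1 := B.kle y hy
  have h0 := B.k0_pos y hy
  have h2 := (abs_lt.1 hb).1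
  nlinarith [mul_pos hy h0]

lemma PI1 (B : BSys r k0 k1 i0 i1 c S) {b y : ℝ} (hb : |b| < 1) (hy : 0 < y) :
    Pd r k0 k1 b y * (∫ t in (0:ℝ)..y, Real.exp (b * t) * t ^ (r - 1) * i0 t) ≤
      (1 + |b|) / r := by
  have h := B.I1_le hb hy
  have hp := B.Pd_nonneg hb hy
  have hr := B.hr
  have hyr := Real.rpow_pos_of_pos hy (-r)
  have hP : 0 ≤ Pd r k0 k1 b y := by unfold Pd; positivity
  refine (mul_le_mul_of_nonneg_left h hP).trans ?_
  have e : Pd r k0 k1 b y * (Real.exp (b * y) * y ^ r * (i0 y - b * (y * i1 y)) / r) =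
      (k1 y + b * (y * k0 y)) * (i0 y - b * (y * i1 y)) / r := by
    unfold Pd
    rw [Real.rpow_neg hy.le, neg_mul, Real.exp_neg]
    have := (Real.rpow_pos_of_pos hy r).ne'
    field_simp
  rw [e]
  apply div_le_div_of_nonneg_right _ hr.le
  have a1 := B.kle y hy
  have a2 := B.ile hy
  have a3 := B.i0k1_le hy
  have p0 := B.i0_pos y hy
  have p1 := mul_pos hy (B.i1_pos y hy)
  have q0 := mul_pos hy (B.k0_pos y hy)
  have q1 := B.k1_pos y hy
  set I := i0 y
  set J := y * i1 y
  set K := k1 y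
  set N := y * k0 y
  rcases le_total 0 b with h0 | h0
  · rw [abs_of_nonneg h0]
    have s1 : K + b * N ≤ (1 + b) * K := by nlinarith
    have s2 : I - b * J ≤ I := by nlinarith
    calc (K + b * N) * (I - b * J) ≤ (K + b * N) * I := mul_le_mul_of_nonneg_left s2 hp
      _ ≤ (1 + b) * K * I := mul_le_mul_of_nonneg_right s1 p0.le
      _ = (1 + b) * (I * K) := by ring
      _ ≤ (1 + b) * 1 := mul_le_mul_of_nonneg_left a3 (by linarith)
      _ = 1 + b := mul_one _
  · rw [abs_of_nonpos h0]
    have s1 : K + b * N ≤ K := by nlinarith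
    have s2 : I - b * J ≤ (1 + -b) * I := by nlinarith
    calc (K + b * N) * (I - b * J) ≤ (K + b * N) * ((1 + -b) * I) :=
          mul_le_mul_of_nonneg_left s2 hp
      _ ≤ K * ((1 + -b) * I) := mul_le_mul_of_nonneg_right s1 (mul_nonneg (by linarith) p0.le)
      _ = (1 + -b) * (I * K) := by ring
      _ ≤ (1 + -b) * 1 := mul_le_mul_of_nonneg_left a3 (by linarith)
      _ = 1 + -b := mul_one _

lemma PI2 (B : BSys r k0 k1 i0 i1 c S) {b y : ℝ} (hb : |b| < 1) (hy : 0 < y) :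
    Pd r k0 k1 b y * (∫ t in (0:ℝ)..y, Real.exp (b * t) * t ^ r * i0 t) ≤ 2 / (1 - b ^ 2) := by
  have hp := B.Pd_nonneg hb hy
  have hr := B.hr
  have hyr := Real.rpow_pos_of_pos hy (-r)
  have hP : 0 ≤ Pd r k0 k1 b y := by unfold Pd; positivity
  have hq : 0 < 1 - b ^ 2 := by
    have := (sq_lt_one_iff_abs_lt_one b).2 hb
    linarith
  have e : Pd r k0 k1 b y * (Real.exp (b * y) * y ^ r * (y * i1 y)) =
      (k1 y + b * (y * k0 y)) * (y * i1 y) := by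
    unfold Pd
    rw [Real.rpow_neg hy.le, neg_mul, Real.exp_neg]
    have := (Real.rpow_pos_of_pos hy r).ne'
    field_simp
  have a1 := B.kle y hy
  have a2 := B.ile hy
  have a3 := B.i0k1_le hy
  have w := B.wron hy
  have p0 := B.i0_pos y hy
  have p1 := mul_pos hy (B.i1_pos y hy)
  have q0 := mul_pos hy (B.k0_pos y hy)
  have q1 := B.k1_pos y hy
  have w' : i0 y * k1 y + (y * i1 y) * (y * k0 y) = 1 := by rw [← w]; ring
  set X := ∫ t in (0:ℝ)..y, Real.exp (b * t) * t ^ r * i0 t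
  set I := i0 y
  set J := y * i1 y
  set K := k1 y
  set N := y * k0 y
  have hb1 := abs_lt.1 hb
  rcases le_total 0 b with h0 | h0
  · have h := B.I2_le (b := b) h0 le_rfl (by norm_num) hy
    have h' := mul_le_mul_of_nonneg_left h hP
    rw [e] at h'
    have s1 : (K + b * N) * J ≤ 1 := by
      have t1 : K * J ≤ K * I := mul_le_mul_of_nonneg_left a2 q1.le
      have t2 : b * (N * J) ≤ 1 * (N * J) := mul_le_mul_of_nonneg_right hb1.2.le (by positivity)
      nlinarith
    have s2 : (1:ℝ) ≤ 2 / (1 - b ^ 2) := by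
      rw [le_div_iff₀ hq]; nlinarith
    have : Pd r k0 k1 b y * X ≤ 1 := by
      refine le_trans (le_of_eq ?_) (h'.trans s1)
      ring
    linarith
  · have h := B.I2_le (b := b) le_rfl h0 hb1.1 hy
    have h' := mul_le_mul_of_nonneg_left h hP
    rw [e] at h'
    have s1 : (K + b * N) * J ≤ 1 := by
      have t1 : K * J ≤ K * I := mul_le_mul_of_nonneg_left a2 q1.le
      have t2 : b * (N * J) ≤ 0 := mul_nonpos_of_nonpos_of_nonneg h0 (by positivity)
      nlinarith
    have h3 : (1 + b) * (Pd r k0 k1 b y * X) ≤ 1 := by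
      refine le_trans (le_of_eq ?_) (h'.trans s1)
      ring
    rw [le_div_iff₀ hq]
    have h4 := mul_le_mul_of_nonneg_left h3 (show 0 ≤ 1 - b by linarith)
    nlinarith

/-! ### The integrals over `(y,∞)` -/

lemma QK2_pos (B : BSys r k0 k1 i0 i1 c S) {b y : ℝ} (hb : |b| < 1) (hy : 0 < y)
    (hQ : 0 ≤ Qd i0 i1 b y) :
    Qd i0 i1 b y * (∫ t in Set.Ioi y, Real.exp (b * t) * (t * k0 t)) ≤ 1 + |b| := by
  have hK2 := B.K2_eq hb hy
  have n1 := B.K_nonneg1 (b := b) hy.le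
  have nT := B.K_nonnegT (b := b) hy.le
  have a3 := B.i0k1_le hy
  have a2 := B.ile hy
  have p0 := B.i0_pos y hy
  have q1 := B.k1_pos y hy
  have q0 := mul_pos hy (B.k0_pos y hy)
  have hE : Real.exp (-b * y) * Real.exp (b * y) = 1 := by
    rw [← Real.exp_add]; simp
  rcases le_total b 0 with h0 | h0
  · have h1 : ∫ t in Set.Ioi y, Real.exp (b * t) * (t * k0 t) ≤ Real.exp (b * y) * k1 y := by
      rw [hK2]
      have := mul_nonpos_of_nonpos_of_nonneg h0 n1
      linarith
    calc _ ≤ Qd i0 i1 b y * (Real.exp (b * y) * k1 y) := mul_le_mul_of_nonneg_left h1 hQ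
      _ ≤ (1 + |b|) * (Real.exp (-b * y) * i0 y) * (Real.exp (b * y) * k1 y) :=
          mul_le_mul_of_nonneg_right (B.Qd_le b hy) (by positivity)
      _ = (1 + |b|) * ((Real.exp (-b * y) * Real.exp (b * y)) * (i0 y * k1 y)) := by ring
      _ ≤ (1 + |b|) * 1 := by
          rw [hE, one_mul]
          exact mul_le_mul_of_nonneg_left a3 (by positivity)
      _ = 1 + |b| := mul_one _
  · set κ := y * k0 y / k1 y with hκ
    set ρ := y * i1 y / i0 y with hρ
    have hρκ : ρ ≤ κ := B.rho_le_kappa hy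
    have hκ1 : κ ≤ 1 := by rw [hκ, div_le_one q1]; exact B.kle y hy
    have hκ0 : 0 ≤ κ := by positivity
    have hQe : Qd i0 i1 b y = Real.exp (-b * y) * i0 y * (ρ - b) := by
      unfold Qd; rw [hρ]; field_simp
    -- comparison for the tail
    have htail : κ * (∫ t in Set.Ioi y, Real.exp (b * t) * k1 t) ≤
        ∫ t in Set.Ioi y, Real.exp (b * t) * (t * k0 t) := by
      rw [← integral_const_mul]
      have hsub : Set.Ioi y ⊆ Set.Ioi 0 := Set.Ioi_subset_Ioi hy.le
      refine setIntegral_mono_on (((B.int1 b hb).mono_set hsub).const_mul κ)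
        ((B.intT hb).mono_set hsub) measurableSet_Ioi ?_
      intro t ht
      have ht0 : 0 < t := hsub ht
      have := B.kappa_mono (Set.mem_Ioi.2 hy) (Set.mem_Ioi.2 ht0) (le_of_lt ht)
      have h2 : κ ≤ t * k0 t / k1 t := this
      rw [le_div_iff₀ (B.k1_pos t ht0)] at h2
      have := mul_le_mul_of_nonneg_left h2 (Real.exp_pos (b * t)).le
      linarith
    set X := ∫ t in Set.Ioi y, Real.exp (b * t) * (t * k0 t)
    set Y := ∫ t in Set.Ioi y, Real.exp (b * t) * k1 t
    have h1 : (κ - b) * X ≤ κ * (Real.exp (b * y) * k1 y) := by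
      have e1 : κ * X = κ * (Real.exp (b * y) * k1 y) + b * (κ * Y) := by rw [hK2]; ring
      have e2 := mul_le_mul_of_nonneg_left htail h0
      nlinarith
    rw [hQe]
    have hpos : 0 ≤ Real.exp (-b * y) * i0 y := by positivity
    calc Real.exp (-b * y) * i0 y * (ρ - b) * X
        ≤ Real.exp (-b * y) * i0 y * (κ - b) * X := by
          refine mul_le_mul_of_nonneg_right (mul_le_mul_of_nonneg_left (by linarith) hpos) nT
      _ = Real.exp (-b * y) * i0 y * ((κ - b) * X) := by ring
      _ ≤ Real.exp (-b * y) * i0 y * (κ * (Real.exp (b * y) * k1 y)) :=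
          mul_le_mul_of_nonneg_left h1 hpos
      _ = (Real.exp (-b * y) * Real.exp (b * y)) * (κ * (i0 y * k1 y)) := by ring
      _ ≤ 1 + |b| := by
          rw [hE, one_mul]
          have : κ * (i0 y * k1 y) ≤ 1 * 1 := mul_le_mul hκ1 a3 (by positivity) (by norm_num)
          have := abs_nonneg b
          linarith

lemma b_pos_of_Qd_neg (B : BSys r k0 k1 i0 i1 c S) {b y : ℝ} (hy : 0 < y)
    (hQ : Qd i0 i1 b y < 0) : 0 < b := by
  by_contra hcon
  push Not at hcon
  have p0 := B.i0_pos y hy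
  have p1 := mul_pos hy (B.i1_pos y hy)
  have : 0 ≤ Qd i0 i1 b y := by
    unfold Qd
    refine mul_nonneg (Real.exp_pos _).le ?_
    nlinarith
  linarith

lemma QK2_neg (B : BSys r k0 k1 i0 i1 c S) {b y : ℝ} (hb : |b| < 1) (hy : 0 < y)
    (hQ : Qd i0 i1 b y < 0) :
    -Qd i0 i1 b y * (∫ t in Set.Ioi y, Real.exp (b * t) * (t * k0 t)) ≤
      1 + |b| * (|b| * (S * r * (1 - b ^ 2) ^ (-(r / 2) - 1))) := by
  have hb0 := B.b_pos_of_Qd_neg hy hQ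
  rw [abs_of_pos hb0]
  have hb1 : b < 1 := lt_of_abs_lt hb
  rw [B.K2_eq hb hy, mul_add]
  have n1 := B.K_nonneg1 (b := b) hy.le
  have a3 := B.i0k1_le hy
  have p0 := B.i0_pos y hy
  have p1 := mul_pos hy (B.i1_pos y hy)
  have q1 := B.k1_pos y hy
  have hE : Real.exp (-b * y) * Real.exp (b * y) = 1 := by
    rw [← Real.exp_add]; simp
  have h1 : -Qd i0 i1 b y * (Real.exp (b * y) * k1 y) ≤ 1 := by
    have : -Qd i0 i1 b y * (Real.exp (b * y) * k1 y) =
      (Real.exp (-b * y) * Real.exp (b * y)) * ((b * i0 y - y * i1 y) * k1 y) := by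
      unfold Qd; ring
    rw [this, hE, one_mul]
    have : (b * i0 y - y * i1 y) * k1 y ≤ i0 y * k1 y :=
      mul_le_mul_of_nonneg_right (by nlinarith) q1.le
    linarith
  have h2 : -Qd i0 i1 b y ≤ b * c := by linarith [B.Qd_ge b hy]
  have h3 : ∫ t in Set.Ioi y, Real.exp (b * t) * k1 t ≤
      ∫ t in Set.Ioi 0, Real.exp (b * t) * k1 t := by
    refine setIntegral_mono_set (B.int1 b hb) ?_ (Set.Ioi_subset_Ioi hy.le).eventuallyLE
    filter_upwards [ae_restrict_mem measurableSet_Ioi] with t ht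
    exact mul_nonneg (Real.exp_pos _).le (B.k1_pos t ht).le
  have h4 := B.tot1 b hb
  have hc := B.hc
  set X := ∫ t in Set.Ioi y, Real.exp (b * t) * k1 t
  set Y := ∫ t in Set.Ioi 0, Real.exp (b * t) * k1 t
  have h5 : -Qd i0 i1 b y * (b * X) ≤ b * (b * (c * Y)) := by
    calc -Qd i0 i1 b y * (b * X) ≤ b * c * (b * X) :=
          mul_le_mul_of_nonneg_right h2 (by positivity)
      _ ≤ b * c * (b * Y) := by gcongr
      _ = b * (b * (c * Y)) := by ring
  have h6 : b * (b * (c * Y)) ≤ b * (b * (S * r * (1 - b ^ 2) ^ (-(r / 2) - 1))) := by gcongr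
  linarith

lemma QK1_neg (B : BSys r k0 k1 i0 i1 c S) {b y : ℝ} (hb : |b| < 1) (hy : 0 < y)
    (hQ : Qd i0 i1 b y < 0) :
    -Qd i0 i1 b y * (∫ t in Set.Ioi y, Real.exp (b * t) * k0 t) ≤
      |b| * (S * (1 - b ^ 2) ^ (-(r / 2))) := by
  have hb0 := B.b_pos_of_Qd_neg hy hQ
  rw [abs_of_pos hb0]
  have h2 : -Qd i0 i1 b y ≤ b * c := by linarith [B.Qd_ge b hy]
  have n0 := B.K_nonneg0 (b := b) hy.le
  have h3 : ∫ t in Set.Ioi y, Real.exp (b * t) * k0 t ≤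
      ∫ t in Set.Ioi 0, Real.exp (b * t) * k0 t := by
    refine setIntegral_mono_set (B.int0 b hb) ?_ (Set.Ioi_subset_Ioi hy.le).eventuallyLE
    filter_upwards [ae_restrict_mem measurableSet_Ioi] with t ht
    exact mul_nonneg (Real.exp_pos _).le (B.k0_pos t ht).le
  have h4 := B.tot0 b hb
  have hc := B.hc
  calc _ ≤ b * c * (∫ t in Set.Ioi y, Real.exp (b * t) * k0 t) :=
        mul_le_mul_of_nonneg_right h2 n0
    _ ≤ b * c * (∫ t in Set.Ioi 0, Real.exp (b * t) * k0 t) := by gcongr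
    _ = b * (c * (∫ t in Set.Ioi 0, Real.exp (b * t) * k0 t)) := by ring
    _ ≤ _ := by gcongr

lemma QK1_pos (B : BSys r k0 k1 i0 i1 c S) {b y δ : ℝ} (hb : |b| < 1) (hy : 0 < y)
    (hQ : 0 ≤ Qd i0 i1 b y) (hδ : 0 < δ) {g : ℝ → ℝ}
    (hg : ∀ t, 0 < t → t ≤ δ → (1 + |b|) * (i0 t * k0 t) ≤ g t)
    (hgi : IntegrableOn g (Set.Ioc 0 δ)) :
    Qd i0 i1 b y * (∫ t in Set.Ioi y, Real.exp (b * t) * k0 t) ≤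
      (1 + |b|) / δ + ∫ t in Set.Ioc 0 δ, g t := by
  have hsub : Set.Ioi y ⊆ Set.Ioi 0 := Set.Ioi_subset_Ioi hy.le
  have hg0 : ∀ t, 0 < t → t ≤ δ → 0 ≤ g t := fun t h1 h2 => by
    refine le_trans ?_ (hg t h1 h2)
    have := B.i0_pos t h1
    have := B.k0_pos t h1
    positivity
  have hind : Integrable ((Set.Ioc 0 δ).indicator g) := hgi.integrable_indicator measurableSet_Ioc
  have j1 := ((B.intT hb).mono_set hsub).const_mul (Qd i0 i1 b y / δ)
  have step : ∫ t in Set.Ioi y, Qd i0 i1 b y * (Real.exp (b * t) * k0 t) ≤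
      ∫ t in Set.Ioi y, (Qd i0 i1 b y / δ * (Real.exp (b * t) * (t * k0 t)) +
        (Set.Ioc 0 δ).indicator g t) := by
    refine setIntegral_mono_on (((B.int0 b hb).mono_set hsub).const_mul _)
      (j1.add hind.integrableOn) measurableSet_Ioi ?_
    intro t ht
    have ht0 : 0 < t := hsub ht
    have q0 := B.k0_pos t ht0
    by_cases htd : t ≤ δ
    · rw [Set.indicator_of_mem (show t ∈ Set.Ioc 0 δ from ⟨ht0, htd⟩)]
      have m := (B.Qd_mono b hy ht0 (le_of_lt ht)).trans (B.Qd_le b ht0)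
      have hE : Real.exp (-b * t) * Real.exp (b * t) = 1 := by
        rw [← Real.exp_add]; simp
      have m2 : Qd i0 i1 b y * (Real.exp (b * t) * k0 t) ≤ (1 + |b|) * (i0 t * k0 t) := by
        calc _ ≤ (1 + |b|) * (Real.exp (-b * t) * i0 t) * (Real.exp (b * t) * k0 t) :=
              mul_le_mul_of_nonneg_right m (by positivity)
          _ = (Real.exp (-b * t) * Real.exp (b * t)) * ((1 + |b|) * (i0 t * k0 t)) := by ring
          _ = _ := by rw [hE, one_mul]
      have m3 : 0 ≤ Qd i0 i1 b y / δ * (Real.exp (b * t) * (t * k0 t)) := by positivity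
      linarith [hg t ht0 htd]
    · rw [Set.indicator_of_notMem (fun h => htd h.2), add_zero]
      push Not at htd
      have : 1 ≤ t / δ := by rw [one_le_div hδ]; exact htd.le
      have m3 : 0 ≤ Qd i0 i1 b y * (Real.exp (b * t) * k0 t) := by positivity
      calc _ ≤ Qd i0 i1 b y * (Real.exp (b * t) * k0 t) * (t / δ) := le_mul_of_one_le_right m3 this
        _ = _ := by ring
  rw [integral_const_mul, integral_add j1 hind.integrableOn, integral_const_mul,
    setIntegral_indicator measurableSet_Ioc] at step
  have hK := B.QK2_pos hb hy hQ
  have e1 : Qd i0 i1 b y / δ * (∫ t in Set.Ioi y, Real.exp (b * t) * (t * k0 t)) ≤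
      (1 + |b|) / δ := by
    rw [div_mul_eq_mul_div]
    exact div_le_div_of_nonneg_right hK hδ.le
  have e2 : ∫ t in Set.Ioi y ∩ Set.Ioc 0 δ, g t ≤ ∫ t in Set.Ioc 0 δ, g t := by
    refine setIntegral_mono_set hgi ?_ Set.inter_subset_right.eventuallyLE
    filter_upwards [ae_restrict_mem measurableSet_Ioc] with t ht
    exact hg0 t ht.1 ht.2
  linarith

end BSys


noncomputable def A0 (r b : ℝ) : ℝ :=
  if 2 ≤ r then 2 * Real.sqrt Real.pi / Real.sqrt (2 * r - 1) * (1 - b ^ 2) ^ (-(r / 2))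
  else 12 * Real.Gamma (r / 2) / (1 - b ^ 2)

lemma gamma_half_lower {r : ℝ} (hr : 0 < r) (hr2 : r < 2) : 1 / r ≤ Real.Gamma (r / 2) := by
  have h1 : Real.Gamma (r / 2 + 1) = r / 2 * Real.Gamma (r / 2) :=
    Real.Gamma_add_one (by positivity)
  have hconv := Real.convexOn_Gamma
  have hl := Real.Gamma_mul_add_mul_le_rpow_Gamma_mul_rpow_Gamma (s := r / 2 + 1)
    (t := 3 - r / 2) (a := 1/2) (b := 1/2) (by linarith) (by linarith) (by norm_num) (by norm_num)
    (by norm_num)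
  have e2 : (1/2 : ℝ) * (r / 2 + 1) + 1/2 * (3 - r/2) = 2 := by ring
  rw [e2, Real.Gamma_two, ← Real.sqrt_eq_rpow, ← Real.sqrt_eq_rpow] at hl
  have p1 : 0 < Real.Gamma (r / 2 + 1) := Real.Gamma_pos_of_pos (by linarith)
  have p2 : 0 < Real.Gamma (3 - r / 2) := Real.Gamma_pos_of_pos (by linarith)
  have h4 : Real.Gamma (3 - r / 2) ≤ 2 := by
    have hc2 := hconv.2
    have := hc2 (show (2:ℝ) ∈ Set.Ioi 0 by simp) (show (3:ℝ) ∈ Set.Ioi 0 by simp)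
      (show 0 ≤ r / 2 by linarith) (show 0 ≤ 1 - r / 2 by linarith) (by ring)
    have g3 : Real.Gamma 3 = 2 := by
      have := Real.Gamma_nat_eq_factorial 2
      rw [show (3:ℝ) = ((2:ℕ):ℝ) + 1 by norm_num, this]
      norm_num [Nat.factorial]
    simp only [smul_eq_mul, Real.Gamma_two, g3] at this
    have e : r / 2 * 2 + (1 - r / 2) * 3 = 3 - r / 2 := by ring
    rw [e] at this
    linarith
  rw [← Real.sqrt_mul p1.le, Real.le_sqrt' one_pos] at hl
  have h5 : 1 ≤ Real.Gamma (r / 2 + 1) * 2 := by nlinarith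
  rw [h1] at h5
  rw [div_le_iff₀ hr]
  linarith

lemma one_add_abs_mul {b : ℝ} (hb : |b| < 1) : (1 + |b|) * (1 - b ^ 2) ≤ 32 / 27 := by
  rw [← sq_abs]
  have h0 := abs_nonneg b
  nlinarith [mul_nonneg (sq_nonneg (|b| - 1/3)) (by linarith : (0:ℝ) ≤ |b| + 5/3)]

namespace BSys

variable {r c S : ℝ} {k0 k1 i0 i1 : ℝ → ℝ}

lemma mpart (B : BSys r k0 k1 i0 i1 c S) {b y : ℝ} (hb : |b| < 1) (hy : 0 < y) :
    Pd r k0 k1 b y * (∫ t in (0:ℝ)..y, Real.exp (b * t) * t ^ (r - 1) * i0 t) +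
    |Qd i0 i1 b y| * (∫ t in Set.Ioi y, Real.exp (b * t) * k0 t) ≤ 2 * A0 r b := by
  have hr := B.hr
  have hI := B.PI1 hb hy
  have hb0 := abs_nonneg b
  have hq : 0 < 1 - b ^ 2 := by rw [← sq_abs]; nlinarith
  have hq1 : 1 - b ^ 2 ≤ 1 := by nlinarith [sq_nonneg b]
  have hπ : (1.5:ℝ) ≤ Real.sqrt Real.pi := by
    rw [Real.le_sqrt' (by norm_num)]; nlinarith [Real.pi_gt_three]
  have hS := B.Sle
  set q := 1 - b ^ 2 with hqdef
  unfold A0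
  rw [← hqdef]
  by_cases h2 : 2 ≤ r
  · rw [if_pos h2]
    set w := Real.sqrt (2 * r - 1) with hw
    have hwsq : w ^ 2 = 2 * r - 1 := Real.sq_sqrt (by linarith)
    have hw0 : 0 < w := Real.sqrt_pos.2 (by linarith)
    have hwr : w ≤ r := by rw [hw, Real.sqrt_le_left hr.le]; nlinarith [sq_nonneg (r-1)]
    set Z := q ^ (-(r / 2)) with hZ
    have hZq : 1 / q ≤ Z := by
      rw [hZ, one_div, ← Real.rpow_neg_one]
      exact Real.rpow_le_rpow_of_exponent_ge hq hq1 (by linarith)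
    have hZ1 : 1 ≤ Z := le_trans (by rw [le_div_iff₀ hq]; linarith) hZq
    by_cases hQ : 0 ≤ Qd i0 i1 b y
    · rw [abs_of_nonneg hQ]
      have hδ : 0 < Real.sqrt (r - 1) := Real.sqrt_pos.2 (by linarith)
      have hδsq : Real.sqrt (r - 1) ^ 2 = r - 1 := Real.sq_sqrt (by linarith)
      have hK := B.QK1_pos hb hy hQ hδ (g := fun _ => (1 + |b|) / (r - 1)) (by
        intro t ht _
        have h1 := B.kge t ht
        have h2 := B.i0k1_le ht
        have h3 := B.i0_pos t ht
        rw [le_div_iff₀ (by linarith)]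
        have : i0 t * ((r - 1) * k0 t) ≤ 1 := le_trans (mul_le_mul_of_nonneg_left h1 h3.le) h2
        nlinarith) (by
        exact integrableOn_const (by simp))
      rw [setIntegral_const] at hK
      simp only [measureReal_def, Real.volume_Ioc, sub_zero, ENNReal.toReal_ofReal hδ.le,
        smul_eq_mul] at hK
      set δ := Real.sqrt (r - 1) with hδdef
      have hK' : (1 + |b|) / δ + δ * ((1 + |b|) / (r - 1)) = (1 + |b|) * (2 / δ) := by
        rw [← hδsq]; field_simp; ring
      have h1 : 1 / r ≤ 1 / w := one_div_le_one_div_of_le hw0 hwr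
      have h3 : 2 / δ ≤ 3.48 / w := by
        rw [div_le_div_iff₀ hδ hw0]
        have : w ≤ 1.74 * δ := by
          rw [hw, Real.sqrt_le_left (by positivity)]
          nlinarith
        linarith
      have h5 : 1 + |b| ≤ 32 / 27 * Z := by
        have h6 := one_add_abs_mul hb
        have : 1 + |b| ≤ 32 / 27 * (1 / q) := by
          rw [mul_one_div, le_div_iff₀ hq]; exact h6
        linarith
      have h7 : (1 + |b|) / r + (1 + |b|) * (2 / δ) ≤ (32 / 27 * Z) * (4.48 / w) := by
        have : (1 + |b|) / r + (1 + |b|) * (2 / δ) = (1 + |b|) * (1 / r + 2 / δ) := by ring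
        rw [this]
        have h8 : 1 / r + 2 / δ ≤ 4.48 / w := by
          have : (4.48:ℝ) / w = 1 / w + 3.48 / w := by ring
          linarith
        gcongr
      have h9 : (32 / 27 * Z) * (4.48 / w) ≤ 2 * (2 * Real.sqrt Real.pi / w * Z) := by
        have : 2 * (2 * Real.sqrt Real.pi / w * Z) - (32 / 27 * Z) * (4.48 / w)
          = (4 * Real.sqrt Real.pi - 32 / 27 * 4.48) * (Z / w) := by ring
        have h10 : 0 ≤ (4 * Real.sqrt Real.pi - 32 / 27 * 4.48) * (Z / w) :=
          mul_nonneg (by linarith) (by positivity)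
        linarith
      linarith
    · push Not at hQ
      rw [abs_of_neg hQ]
      have hK := B.QK1_neg hb hy hQ
      rw [← hqdef, ← hZ] at hK
      have h1 : (1 + |b|) / r ≤ 2 / w := by gcongr; linarith
      have h3 : Real.sqrt (2 * Real.pi * (r + 1)) / r ≤ 2.5 * Real.sqrt Real.pi / w := by
        rw [div_le_div_iff₀ hr hw0, hw, ← Real.sqrt_mul (by positivity),
          Real.sqrt_le_left (by positivity), mul_pow, mul_pow, Real.sq_sqrt Real.pi_pos.le]
        nlinarith [Real.pi_pos, mul_nonneg Real.pi_pos.le (sq_nonneg (r-2)),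
          mul_nonneg Real.pi_pos.le (sq_nonneg r)]
      have h4 : |b| * (S * Z) ≤ 2.5 * Real.sqrt Real.pi / w * Z := by
        have hx : 0 ≤ 2.5 * Real.sqrt Real.pi / w * Z := by positivity
        have : S * Z ≤ 2.5 * Real.sqrt Real.pi / w * Z := by
          gcongr; linarith
        nlinarith
      have h5 : 2 / w ≤ 2 / w * Z := le_mul_of_one_le_right (by positivity) hZ1
      have h9 : 2 / w * Z + 2.5 * Real.sqrt Real.pi / w * Z ≤
          2 * (2 * Real.sqrt Real.pi / w * Z) := by
        have : 2 * (2 * Real.sqrt Real.pi / w * Z) - (2 / w * Z + 2.5 * Real.sqrt Real.pi / w * Z)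
          = (1.5 * Real.sqrt Real.pi - 2) * (Z / w) := by ring
        have h10 : 0 ≤ (1.5 * Real.sqrt Real.pi - 2) * (Z / w) :=
          mul_nonneg (by linarith) (by positivity)
        linarith
      linarith
  · rw [if_neg h2]
    push Not at h2
    have hG := gamma_half_lower hr h2
    have hT : 24 / r * (1 / q) ≤ 2 * (12 * Real.Gamma (r / 2) / q) := by
      have : 24 / r * (1 / q) = 24 * (1 / r) * (1 / q) := by ring
      have e : 2 * (12 * Real.Gamma (r / 2) / q) = 24 * Real.Gamma (r / 2) * (1 / q) := by ring
      rw [this, e]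
      gcongr
    have hq1' : 1 ≤ 1 / q := by rw [le_div_iff₀ hq]; linarith
    have hI2 : (1 + |b|) / r ≤ 2 / r := by gcongr; linarith
    have hsq : Real.sqrt (2 * Real.pi * (r + 1)) ≤ 4.4 := by
      rw [Real.sqrt_le_left (by norm_num)]
      nlinarith [Real.pi_lt_d2, Real.pi_pos]
    have hS2 : S ≤ 4.4 / r := hS.trans (by gcongr)
    have hr1 : 2 ≤ 4 / r := by rw [le_div_iff₀ hr]; linarith
    have hpos : 0 < 1 / r := by positivity
    refine le_trans ?_ hT
    by_cases hQ : 0 ≤ Qd i0 i1 b y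
    · rw [abs_of_nonneg hQ]
      have hIntg : IntegrableOn k0 (Set.Ioi 0) := by
        simpa using B.int0 0 (by simp)
      have hK := B.QK1_pos hb hy hQ one_pos (g := fun t => (1 + |b|) * (c * Real.exp 1) * k0 t) (by
        intro t ht ht1
        have h1 := B.i0_le_exp ht
        have h3 := B.k0_pos t ht
        have h4 : c * Real.exp t ≤ c * Real.exp 1 :=
          mul_le_mul_of_nonneg_left (Real.exp_le_exp.2 ht1) B.hc.le
        rw [mul_assoc]
        gcongr
        linarith) (by
        exact (hIntg.mono_set Set.Ioc_subset_Ioi_self).const_mul _)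
      rw [integral_const_mul] at hK
      have h1 : ∫ t in Set.Ioc 0 1, k0 t ≤ ∫ t in Set.Ioi 0, k0 t := by
        refine setIntegral_mono_set hIntg ?_ (Set.Ioc_subset_Ioi_self).eventuallyLE
        filter_upwards [ae_restrict_mem measurableSet_Ioi] with t ht
        exact (B.k0_pos t ht).le
      have h3 : c * ∫ t in Set.Ioc 0 1, k0 t ≤ S / 2 :=
        (mul_le_mul_of_nonneg_left h1 B.hc.le).trans B.half0
      have h4 : 0 ≤ c * ∫ t in Set.Ioc 0 1, k0 t := mul_nonneg B.hc.le
        (setIntegral_nonneg measurableSet_Ioc fun t ht => (B.k0_pos t ht.1).le)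
      have he := Real.exp_one_lt_d9
      have h5 : (1 + |b|) * (c * Real.exp 1) * ∫ t in Set.Ioc 0 1, k0 t ≤ 2 * 2.72 * (S / 2) := by
        have : (1 + |b|) * (c * Real.exp 1) * ∫ t in Set.Ioc 0 1, k0 t
          = ((1 + |b|) * Real.exp 1) * (c * ∫ t in Set.Ioc 0 1, k0 t) := by ring
        rw [this]
        gcongr <;> linarith
      have e1 : (4.4:ℝ) / r = 4.4 * (1 / r) := by ring
      have e2 : (4:ℝ) / r = 4 * (1 / r) := by ring
      have e3 : (2:ℝ) / r = 2 * (1 / r) := by ring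
      have e4 : (24:ℝ) / r ≤ 24 / r * (1 / q) := le_mul_of_one_le_right (by positivity) hq1'
      have e5 : (24:ℝ) / r = 24 * (1 / r) := by ring
      rw [div_one] at hK
      linarith
    · push Not at hQ
      rw [abs_of_neg hQ]
      have hK := B.QK1_neg hb hy hQ
      rw [← hqdef] at hK
      have hZq : q ^ (-(r / 2)) ≤ 1 / q := by
        rw [one_div, ← Real.rpow_neg_one]
        exact Real.rpow_le_rpow_of_exponent_ge hq hq1 (by linarith)
      have hZ0 : 0 < q ^ (-(r / 2)) := Real.rpow_pos_of_pos hq _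
      have h4 : |b| * (S * q ^ (-(r / 2))) ≤ 4.4 / r * (1 / q) := by
        have hx : 0 ≤ 4.4 / r * (1 / q) := by positivity
        have : S * q ^ (-(r / 2)) ≤ 4.4 / r * (1 / q) := by
          gcongr
        nlinarith
      have h5 : 2 / r ≤ 2 / r * (1 / q) := le_mul_of_one_le_right (by positivity) hq1'
      have h9 : 2 / r * (1 / q) + 4.4 / r * (1 / q) ≤ 24 / r * (1 / q) := by
        rw [← add_mul]
        gcongr
        rw [← add_div]
        gcongr
        norm_num
      linarith

lemma tpart (B : BSys r k0 k1 i0 i1 c S) {b y : ℝ} (hb : |b| < 1) (hy : 0 < y) :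
    Pd r k0 k1 b y * (∫ t in (0:ℝ)..y, Real.exp (b * t) * t ^ r * i0 t) +
    |Qd i0 i1 b y| * (∫ t in Set.Ioi y, Real.exp (b * t) * (t * k0 t)) ≤
    (6 + 2 * Real.sqrt (2 * Real.pi * (r + 1)) * (|b| * (1 - b ^ 2) ^ (-(r / 2)))) /
      (1 - b ^ 2) := by
  have hr := B.hr
  have hI := B.PI2 hb hy
  have hb0 := abs_nonneg b
  have hq : 0 < 1 - b ^ 2 := by rw [← sq_abs]; nlinarith
  have hq1 : 1 - b ^ 2 ≤ 1 := by nlinarith [sq_nonneg b]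
  have hS := B.Sle
  set q := 1 - b ^ 2 with hqdef
  have hZ0 : 0 < q ^ (-(r / 2)) := Real.rpow_pos_of_pos hq _
  set W := Real.sqrt (2 * Real.pi * (r + 1)) with hW
  have hW0 : 0 ≤ W := Real.sqrt_nonneg _
  have hSr : S * r ≤ W := by rwa [le_div_iff₀ hr] at hS
  have hZ : q ^ (-(r / 2) - 1) = q ^ (-(r / 2)) / q := by
    rw [Real.rpow_sub hq, Real.rpow_one]
  have hq1' : 1 ≤ 1 / q := by rw [le_div_iff₀ hq]; linarith
  have hx : 0 ≤ W * (|b| * q ^ (-(r / 2))) / q := by positivity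
  have e : (6 + 2 * W * (|b| * q ^ (-(r / 2)))) / q = 6 * (1 / q) +
    2 * (W * (|b| * q ^ (-(r / 2))) / q) := by ring
  have e2 : 2 / q = 2 * (1 / q) := by ring
  rw [e]
  by_cases hQ : 0 ≤ Qd i0 i1 b y
  · rw [abs_of_nonneg hQ]
    have := B.QK2_pos hb hy hQ
    linarith
  · push Not at hQ
    rw [abs_of_neg hQ]
    have h := B.QK2_neg hb hy hQ
    rw [← hqdef, hZ] at h
    have h3 : |b| * (|b| * (S * r * (q ^ (-(r / 2)) / q))) ≤ W * (|b| * q ^ (-(r / 2))) / q := by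
      have h4 : |b| * (S * r * (q ^ (-(r / 2)) / q)) ≤ |b| * (W * (q ^ (-(r / 2)) / q)) := by
        gcongr
      have h5 : |b| * (W * (q ^ (-(r / 2)) / q)) = W * (|b| * q ^ (-(r / 2))) / q := by ring
      rw [h5] at h4
      nlinarith
    linarith

lemma core (B : BSys r k0 k1 i0 i1 c S) {b y M : ℝ} (hb : |b| < 1) (hy : 0 < y) (hM : 0 ≤ M)
    (hM2 : M * (1 - b ^ 2) ≤ Real.sqrt (2 * r) + r) :
    Pd r k0 k1 b y * ((∫ t in (0:ℝ)..y, Real.exp (b * t) * t ^ r * i0 t) +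
      M * (∫ t in (0:ℝ)..y, Real.exp (b * t) * t ^ (r - 1) * i0 t)) +
    |Qd i0 i1 b y| * ((∫ t in Set.Ioi y, Real.exp (b * t) * (t * k0 t)) +
      M * (∫ t in Set.Ioi y, Real.exp (b * t) * k0 t)) ≤
    (6 + 2 * Real.sqrt (2 * Real.pi * (r + 1)) * (|b| * (1 - b ^ 2) ^ (-(r / 2))) +
      2 * (Real.sqrt (2 * r) + r) * A0 r b) / (1 - b ^ 2) := by
  have h1 := B.tpart hb hy
  have h2 := mul_le_mul_of_nonneg_left (B.mpart hb hy) hM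
  have hb0 := abs_nonneg b
  have hq : 0 < 1 - b ^ 2 := by rw [← sq_abs]; nlinarith
  have hA : 0 ≤ A0 r b := by
    unfold A0
    have := Real.Gamma_pos_of_pos (half_pos B.hr)
    split_ifs <;> positivity
  have h3 : M * (2 * A0 r b) ≤ 2 * (Real.sqrt (2 * r) + r) * A0 r b / (1 - b ^ 2) := by
    rw [le_div_iff₀ hq]
    nlinarith
  rw [add_div]
  linarith

end BSys


noncomputable def Phi (r : ℝ) (k0 i0 : ℝ → ℝ) (b : ℝ) (H : ℝ → ℝ) (y : ℝ) : ℝ :=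
  Real.exp (-b * y) * y ^ (1 - r) * k0 y *
      (∫ t in (0:ℝ)..y, Real.exp (b * t) * t ^ (r - 1) * i0 t * H t) +
    Real.exp (-b * y) * i0 y * (∫ t in Set.Ioi y, Real.exp (b * t) * k0 t * H t)

namespace BSys

variable {r c S : ℝ} {k0 k1 i0 i1 : ℝ → ℝ}

lemma intKH (B : BSys r k0 k1 i0 i1 c S) {b ℓ M : ℝ} {H : ℝ → ℝ} (hb : |b| < 1)
    (hH : Continuous H) (hHb : ∀ t, |H t| ≤ ℓ * (|t| + M)) :
    IntegrableOn (fun t => Real.exp (b * t) * k0 t * H t) (Set.Ioi 0) := by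
  have h1 := ((B.intT hb).add ((B.int0 b hb).const_mul M)).const_mul ℓ
  refine Integrable.mono' h1 ?_ ?_
  · have h := B.ck0
    have : ContinuousOn (fun t => Real.exp (b * t) * k0 t * H t) (Set.Ioi 0) := by fun_prop
    exact this.aestronglyMeasurable measurableSet_Ioi
  · filter_upwards [ae_restrict_mem measurableSet_Ioi] with t ht
    have ht : 0 < t := ht
    have h0 := B.k0_pos t ht
    have h2 := hHb t
    rw [abs_of_pos ht] at h2
    rw [Real.norm_eq_abs, abs_mul, abs_of_pos (by positivity : 0 < Real.exp (b * t) * k0 t)]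
    calc _ ≤ Real.exp (b * t) * k0 t * (ℓ * (t + M)) := by gcongr
      _ = _ := by simp only [Pi.add_apply]; ring

lemma Phi_deriv (B : BSys r k0 k1 i0 i1 c S) {b ℓ M y : ℝ} {H : ℝ → ℝ} (hb : |b| < 1)
    (hH : Continuous H) (hHb : ∀ t, |H t| ≤ ℓ * (|t| + M)) (hy : 0 < y) :
    HasDerivAt (Phi r k0 i0 b H)
      (-Pd r k0 k1 b y * (∫ t in (0:ℝ)..y, Real.exp (b * t) * t ^ (r - 1) * i0 t * H t) +
       Qd i0 i1 b y * (∫ t in Set.Ioi y, Real.exp (b * t) * k0 t * H t)) y := by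
  have hci := B.ci0
  have hck := B.ck0
  have hde : HasDerivAt (fun t => Real.exp (-b * t)) (-b * Real.exp (-b * y)) y := by
    have := ((hasDerivAt_id y).const_mul (-b)).exp
    refine this.congr_deriv ?_
    simp; ring
  have hmem : Set.Ioi (0:ℝ) ∈ nhds y := Ioi_mem_nhds hy
  -- first integral
  have c1 : ContinuousOn (fun t => Real.exp (b * t) * t ^ (r - 1) * i0 t * H t) (Set.Ioi 0) := by
    have : ContinuousOn (fun t : ℝ => t ^ (r - 1)) (Set.Ioi 0) := fun t ht =>
      (Real.continuousAt_rpow_const t (r - 1) (Or.inl (ne_of_gt ht))).continuousWithinAt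
    fun_prop
  have d1 : HasDerivAt (fun z => ∫ t in (0:ℝ)..z, Real.exp (b * t) * t ^ (r - 1) * i0 t * H t)
      (Real.exp (b * y) * y ^ (r - 1) * i0 y * H y) y := by
    refine intervalIntegral.integral_hasDerivAt_right ?_ ?_ ?_
    · exact (B.intI1 b y).mul_continuousOn hH.continuousOn
    · exact c1.stronglyMeasurableAtFilter isOpen_Ioi y hy
    · exact c1.continuousAt hmem
  have c2 : ContinuousOn (fun t => Real.exp (b * t) * k0 t * H t) (Set.Ioi 0) := by fun_prop
  have hIntg := B.intKH hb hH hHb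
  have d2 : HasDerivAt (fun z => ∫ t in Set.Ioi z, Real.exp (b * t) * k0 t * H t)
      (-(Real.exp (b * y) * k0 y * H y)) y := by
    have h3 : HasDerivAt (fun z => (∫ t in Set.Ioi 0, Real.exp (b * t) * k0 t * H t) -
        ∫ t in (0:ℝ)..z, Real.exp (b * t) * k0 t * H t)
        (-(Real.exp (b * y) * k0 y * H y)) y := by
      refine HasDerivAt.const_sub _ ?_
      refine intervalIntegral.integral_hasDerivAt_right ?_ ?_ ?_
      · rw [intervalIntegrable_iff_integrableOn_Ioc_of_le hy.le]
        exact hIntg.mono_set Set.Ioc_subset_Ioi_self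
      · exact c2.stronglyMeasurableAtFilter isOpen_Ioi y hy
      · exact c2.continuousAt hmem
    refine h3.congr_of_eventuallyEq ?_
    filter_upwards [hmem] with z hz
    have := intervalIntegral.integral_interval_add_Ioi hIntg
      (hIntg.mono_set (Set.Ioi_subset_Ioi (le_of_lt hz)))
    linarith
  have dr : HasDerivAt (fun z : ℝ => z ^ (1 - r)) ((1 - r) * y ^ (1 - r - 1)) y :=
    Real.hasDerivAt_rpow_const (Or.inl hy.ne')
  have h := (((hde.mul dr).mul (B.dk0 y hy)).mul d1).add ((hde.mul (B.di0 y)).mul d2)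
  refine h.congr_deriv ?_
  have e1 : y ^ (1 - r - 1) = y ^ (-r) := by congr 1; ring
  have e2 : y ^ (1 - r) = y ^ (-r) * y := by
    rw [show 1 - r = -r + 1 by ring, Real.rpow_add hy, Real.rpow_one]
  have e3 : y ^ (r - 1) = (y ^ (-r))⁻¹ / y := by
    rw [Real.rpow_sub hy, Real.rpow_one, Real.rpow_neg hy.le, inv_inv]
  have hp : 0 < y ^ (-r) := Real.rpow_pos_of_pos hy _
  have e4 : Real.exp (-b * y) = (Real.exp (b * y))⁻¹ := by
    rw [← Real.exp_neg]; congr 1; ring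
  simp only [Pi.mul_apply]
  unfold Pd Qd
  rw [e1, e2, e3, e4]
  have hE := Real.exp_pos (b * y)
  field_simp
  ring

lemma Phi_deriv_bound (B : BSys r k0 k1 i0 i1 c S) {b ℓ M y d : ℝ} {H : ℝ → ℝ} (hb : |b| < 1)
    (hH : Continuous H) (hl : 0 ≤ ℓ) (hM : 0 ≤ M)
    (hM2 : M * (1 - b ^ 2) ≤ Real.sqrt (2 * r) + r)
    (hHb : ∀ t, |H t| ≤ ℓ * (|t| + M)) (hy : 0 < y) (hd : HasDerivAt (Phi r k0 i0 b H) d y) :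
    |d| ≤ ℓ * ((6 + 2 * Real.sqrt (2 * Real.pi * (r + 1)) * (|b| * (1 - b ^ 2) ^ (-(r / 2))) +
      2 * (Real.sqrt (2 * r) + r) * A0 r b) / (1 - b ^ 2)) := by
  rw [hd.unique (B.Phi_deriv hb hH hHb hy)]
  refine le_trans ?_ (mul_le_mul_of_nonneg_left (B.core hb hy hM hM2) hl)
  have hP : 0 ≤ Pd r k0 k1 b y := by
    have := B.Pd_nonneg hb hy
    have hyr := Real.rpow_pos_of_pos hy (-r)
    unfold Pd; positivity
  have hI : |∫ t in (0:ℝ)..y, Real.exp (b * t) * t ^ (r - 1) * i0 t * H t| ≤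
      ℓ * ((∫ t in (0:ℝ)..y, Real.exp (b * t) * t ^ r * i0 t) +
      M * (∫ t in (0:ℝ)..y, Real.exp (b * t) * t ^ (r - 1) * i0 t)) := by
    rw [← intervalIntegral.integral_const_mul, ← intervalIntegral.integral_add (B.intI2 b y)
      ((B.intI1 b y).const_mul M), ← intervalIntegral.integral_const_mul]
    rw [← Real.norm_eq_abs]
    refine intervalIntegral.norm_integral_le_of_norm_le hy.le ?_
      (((B.intI2 b y).add ((B.intI1 b y).const_mul M)).const_mul ℓ)
    refine Eventually.of_forall (fun t ht => ?_)
    have ht0 := ht.1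
    have h0 := B.i0_pos t ht0
    have h2 := hHb t
    have h3 : 0 < t ^ (r - 1) := Real.rpow_pos_of_pos ht0 _
    rw [abs_of_pos ht0] at h2
    rw [Real.norm_eq_abs, abs_mul,
      abs_of_pos (by positivity : 0 < Real.exp (b * t) * t ^ (r - 1) * i0 t)]
    have e : t ^ r = t ^ (r - 1) * t := by
      rw [Real.rpow_sub ht0, Real.rpow_one]; field_simp
    calc _ ≤ Real.exp (b * t) * t ^ (r - 1) * i0 t * (ℓ * (t + M)) := by gcongr
      _ = _ := by rw [e]; ring
  have hK : |∫ t in Set.Ioi y, Real.exp (b * t) * k0 t * H t| ≤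
      ℓ * ((∫ t in Set.Ioi y, Real.exp (b * t) * (t * k0 t)) +
      M * (∫ t in Set.Ioi y, Real.exp (b * t) * k0 t)) := by
    have hsub : Set.Ioi y ⊆ Set.Ioi 0 := Set.Ioi_subset_Ioi hy.le
    have j1 := (B.intT hb).mono_set hsub
    have j2 := (B.int0 b hb).mono_set hsub
    rw [← integral_const_mul, ← integral_add j1 (j2.const_mul M), ← integral_const_mul]
    rw [← Real.norm_eq_abs]
    refine norm_integral_le_of_norm_le ((j1.add (j2.const_mul M)).const_mul ℓ) ?_
    filter_upwards [ae_restrict_mem measurableSet_Ioi] with t ht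
    have ht0 : 0 < t := hsub ht
    have h0 := B.k0_pos t ht0
    have h2 := hHb t
    rw [abs_of_pos ht0] at h2
    rw [Real.norm_eq_abs, abs_mul, abs_of_pos (by positivity : 0 < Real.exp (b * t) * k0 t)]
    calc _ ≤ Real.exp (b * t) * k0 t * (ℓ * (t + M)) := by gcongr
      _ = _ := by ring
  refine (abs_add_le _ _).trans ?_
  rw [abs_mul, abs_mul, abs_neg, abs_of_nonneg hP, mul_add]
  refine add_le_add ?_ ?_
  · calc _ ≤ Pd r k0 k1 b y * _ := mul_le_mul_of_nonneg_left hI hP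
      _ = _ := by ring
  · calc _ ≤ |Qd i0 i1 b y| * _ := mul_le_mul_of_nonneg_left hK (abs_nonneg _)
      _ = _ := by ring

end BSys


noncomputable def kker (μ s u : ℝ) : ℝ :=
  (1 / 2) * u ^ (μ - 1) * Real.exp (-(u / 2) - s / (2 * u))

/-- `y^μ K_μ(y)` in integral form. -/
noncomputable def kk (μ y : ℝ) : ℝ := ∫ u in Set.Ioi (0:ℝ), kker μ (y ^ 2) u

lemma kker_meas (μ s : ℝ) : Measurable (kker μ s) := by unfold kker; fun_prop

lemma kker_pos (μ s : ℝ) {u : ℝ} (hu : 0 < u) : 0 < kker μ s u := by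
  have := Real.rpow_pos_of_pos hu (μ - 1)
  unfold kker; positivity

lemma exp_neg_le_pow {x : ℝ} (hx : 0 < x) (n : ℕ) :
    Real.exp (-x) ≤ (Nat.factorial n : ℝ) * (x⁻¹) ^ n := by
  have h := Real.pow_div_factorial_le_exp x hx.le n
  rw [Real.exp_neg, inv_le_comm₀ (Real.exp_pos _) (by positivity)]
  refine le_trans (le_of_eq ?_) h
  rw [mul_inv, inv_pow, inv_inv]; ring

lemma kker_le {μ s : ℝ} (hs : 0 < s) (n : ℕ) {u : ℝ} (hu : 0 < u) :
    kker μ s u ≤ ((1 / 2) * (Nat.factorial n : ℝ) * (2 / s) ^ n) *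
      (u ^ (μ + n - 1) * Real.exp (-(1 / 2) * u)) := by
  unfold kker
  have h := exp_neg_le_pow (x := s / (2 * u)) (by positivity) n
  rw [sub_eq_add_neg (-(u / 2)), Real.exp_add]
  have e1 : u ^ (μ + n - 1) = u ^ (μ - 1) * u ^ n := by
    rw [show μ + n - 1 = (μ - 1) + n by ring, Real.rpow_add hu, Real.rpow_natCast]
  have e2 : (s / (2 * u))⁻¹ ^ n = (2 / s) ^ n * u ^ n := by
    rw [← mul_pow]; congr 1; field_simp
  rw [e2] at h
  have hp := Real.rpow_pos_of_pos hu (μ - 1)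
  rw [e1, show -(1 / 2) * u = -(u / 2) by ring]
  calc _ ≤ 1 / 2 * u ^ (μ - 1) * (rexp (-(u / 2)) * ((Nat.factorial n : ℝ) * ((2 / s) ^ n * u ^ n))) := by
        gcongr
    _ = _ := by ring

lemma kker_le0 {μ s : ℝ} (hs : 0 ≤ s) {u : ℝ} (hu : 0 < u) :
    kker μ s u ≤ (1 / 2) * (u ^ (μ - 1) * Real.exp (-(1 / 2) * u)) := by
  unfold kker
  have hp := Real.rpow_pos_of_pos hu (μ - 1)
  rw [← mul_assoc]
  gcongr
  have : 0 ≤ s / (2 * u) := by positivity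
  linarith

lemma gam_int {a q : ℝ} (ha : 0 < a) (hq : 0 < q) :
    IntegrableOn (fun u : ℝ => u ^ (a - 1) * Real.exp (-q * u)) (Set.Ioi 0) := by
  have := integrableOn_rpow_mul_exp_neg_mul_rpow (p := 1) (s := a - 1) (b := q) (by linarith)
    one_pos hq
  simpa using this

lemma kker_int (μ : ℝ) {s : ℝ} (hs : 0 < s) : IntegrableOn (kker μ s) (Set.Ioi 0) := by
  obtain ⟨n, hn⟩ := exists_nat_gt (-μ)
  refine Integrable.mono' ((gam_int (a := μ + n) (by linarith) (q := 1 / 2)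
    (by norm_num)).const_mul ((1 / 2) * (Nat.factorial n : ℝ) * (2 / s) ^ n))
    (kker_meas μ s).aestronglyMeasurable ?_
  filter_upwards [ae_restrict_mem measurableSet_Ioi] with u hu
  rw [Real.norm_eq_abs, abs_of_pos (kker_pos μ s hu)]
  exact kker_le hs n hu

lemma kk_pos (μ : ℝ) {y : ℝ} (hy : y ≠ 0) : 0 < kk μ y := by
  have hs : 0 < y ^ 2 := by positivity
  unfold kk
  rw [setIntegral_pos_iff_support_of_nonneg_ae _ (kker_int μ hs)]
  · have : Set.Ioi 0 ⊆ Function.support (kker μ (y ^ 2)) ∩ Set.Ioi 0 :=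
      fun u hu => ⟨(kker_pos μ _ hu).ne', hu⟩
    refine lt_of_lt_of_le ?_ (measure_mono this)
    simp
  · filter_upwards [ae_restrict_mem measurableSet_Ioi] with u hu
    exact (kker_pos μ _ hu).le

lemma kk_nonneg (μ y : ℝ) : 0 ≤ kk μ y :=
  setIntegral_nonneg measurableSet_Ioi fun _ hu => (kker_pos μ _ hu).le

lemma kk_abs (μ y : ℝ) : kk μ |y| = kk μ y := by unfold kk; rw [sq_abs]

lemma kk_neg (μ y : ℝ) : kk μ (-y) = kk μ y := by unfold kk; rw [neg_sq]

lemma kk_hasDerivAt (μ : ℝ) {y : ℝ} (hy : 0 < y) :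
    HasDerivAt (kk μ) (-(y * kk (μ - 1) y)) y := by
  have hs : 0 < y ^ 2 := by positivity
  have hnb : Set.Ioo (y / 2) (2 * y) ∈ nhds y := Ioo_mem_nhds (by linarith) (by linarith)
  have h := hasDerivAt_integral_of_dominated_loc_of_deriv_le
    (μ := volume.restrict (Set.Ioi (0:ℝ))) (F := fun z u => kker μ (z ^ 2) u)
    (F' := fun z u => -(z * kker (μ - 1) (z ^ 2) u))
    (bound := fun u => 2 * y * kker (μ - 1) ((y / 2) ^ 2) u) (x₀ := y) hnb
    (Eventually.of_forall fun z => (kker_meas μ _).aestronglyMeasurable) (kker_int μ hs)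
    (((kker_meas (μ - 1) _).const_mul y).neg.aestronglyMeasurable) ?_
    ((kker_int (μ - 1) (by positivity)).const_mul _) ?_
  · refine h.2.congr_deriv ?_
    rw [integral_neg, integral_const_mul]; rfl
  · filter_upwards [ae_restrict_mem measurableSet_Ioi] with u hu z hz
    have hu : 0 < u := hu
    have hz0 : 0 < z := by linarith [hz.1]
    rw [norm_neg, Real.norm_eq_abs, abs_of_pos (mul_pos hz0 (kker_pos _ _ hu))]
    have hp := Real.rpow_pos_of_pos hu (μ - 1 - 1)
    have : kker (μ - 1) (z ^ 2) u ≤ kker (μ - 1) ((y / 2) ^ 2) u := by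
      unfold kker
      have := hz.1
      gcongr
    exact mul_le_mul hz.2.le this (kker_pos _ _ hu).le (by positivity)
  · filter_upwards [ae_restrict_mem measurableSet_Ioi] with u hu z hz
    have hu : 0 < u := hu
    have h1 : HasDerivAt (fun z : ℝ => -(u / 2) - z ^ 2 / (2 * u)) (-(z / u)) z := by
      have := ((hasDerivAt_pow 2 z).div_const (2 * u)).const_sub (-(u / 2))
      refine this.congr_deriv ?_
      field_simp; norm_num
    have h2 := h1.exp.const_mul ((1 / 2) * u ^ (μ - 1))
    refine h2.congr_deriv ?_
    unfold kker
    rw [Real.rpow_sub hu (μ - 1) 1, Real.rpow_one]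
    ring

lemma kk_rec (μ : ℝ) {y : ℝ} (hy : 0 < y) :
    kk (μ + 1) y = y ^ 2 * kk (μ - 1) y + 2 * μ * kk μ y := by
  have hs : 0 < y ^ 2 := by positivity
  set s := y ^ 2 with hsdef
  have key := integral_Ioi_deriv_mul_eq_sub (a := (0:ℝ)) (a' := 0) (b' := 0)
    (u := fun u : ℝ => u ^ μ) (v := fun u : ℝ => Real.exp (-(u / 2) - s / (2 * u)))
    (u' := fun u : ℝ => μ * u ^ (μ - 1))
    (v' := fun u : ℝ => Real.exp (-(u / 2) - s / (2 * u)) * (-(1 / 2) + s / (2 * u ^ 2)))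
    (fun u hu => Real.hasDerivAt_rpow_const (Or.inl (ne_of_gt hu))) ?_ ?_ ?_ ?_
  · have e : ∀ u ∈ Set.Ioi (0:ℝ), μ * u ^ (μ - 1) * Real.exp (-(u / 2) - s / (2 * u)) +
      u ^ μ * (Real.exp (-(u / 2) - s / (2 * u)) * (-(1 / 2) + s / (2 * u ^ 2))) =
      2 * μ * kker μ s u - kker (μ + 1) s u + s * kker (μ - 1) s u := by
      intro u hu
      have hu : 0 < u := hu
      unfold kker
      rw [Real.rpow_sub hu (μ - 1) 1, Real.rpow_sub hu μ 1, Real.rpow_one, add_sub_cancel_right]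
      field_simp
      ring
    rw [setIntegral_congr_fun measurableSet_Ioi e, integral_add, integral_sub,
      integral_const_mul, integral_const_mul] at key
    · unfold kk; linarith
    · exact (kker_int μ hs).const_mul _
    · exact kker_int _ hs
    · exact ((kker_int μ hs).const_mul _).sub (kker_int _ hs)
    · exact (kker_int _ hs).const_mul _
  · intro u hu
    have hu : 0 < u := hu
    have h1 : HasDerivAt (fun u : ℝ => -(u / 2) - s / (2 * u)) (-(1 / 2) + s / (2 * u ^ 2)) u := by
      have := (((hasDerivAt_id u).div_const 2).neg).sub
        ((((hasDerivAt_id u).const_mul 2).inv (by simp; exact hu.ne')).const_mul s)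
      refine this.congr_deriv ?_
      simp only [id]
      field_simp
      ring
    exact h1.exp
  · have hI : IntegrableOn (fun u => 2 * μ * kker μ s u - kker (μ + 1) s u + s * kker (μ - 1) s u)
        (Set.Ioi 0) := (((kker_int μ hs).const_mul _).sub (kker_int _ hs)).add
        ((kker_int _ hs).const_mul _)
    refine hI.congr_fun ?_ measurableSet_Ioi
    intro u hu
    have hu : 0 < u := hu
    simp only [Pi.add_apply, Pi.mul_apply]
    unfold kker
    rw [Real.rpow_sub hu (μ - 1) 1, Real.rpow_sub hu μ 1, Real.rpow_one, add_sub_cancel_right]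
    field_simp
    ring
  · -- limit at 0
    obtain ⟨n, hn⟩ := exists_nat_gt (-μ)
    have hlim : Tendsto (fun u : ℝ => 2 * (((1 / 2) * (Nat.factorial n : ℝ) * (2 / s) ^ n) *
      (u ^ (μ + n) * Real.exp (-(1 / 2) * u)))) (nhdsWithin 0 (Set.Ioi 0)) (nhds 0) := by
      have hc : Continuous (fun u : ℝ => 2 * (((1 / 2) * (Nat.factorial n : ℝ) * (2 / s) ^ n) *
        (u ^ (μ + n) * Real.exp (-(1 / 2) * u)))) := by
        have := Real.continuous_rpow_const (show 0 ≤ μ + n by linarith)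
        fun_prop
      have := (hc.tendsto 0).mono_left (nhdsWithin_le_nhds (s := Set.Ioi (0:ℝ)))
      rw [Real.zero_rpow (by linarith)] at this
      simpa using this
    refine tendsto_of_tendsto_of_tendsto_of_le_of_le' tendsto_const_nhds hlim ?_ ?_
    · filter_upwards [self_mem_nhdsWithin] with u hu
      have hu : 0 < u := hu
      simp only [Pi.mul_apply]; positivity
    · filter_upwards [self_mem_nhdsWithin] with u hu
      have := kker_le (μ := μ + 1) hs n hu
      unfold kker at this
      rw [add_sub_cancel_right, show μ + 1 + n - 1 = μ + n by ring] at this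
      simp only [Pi.mul_apply]
      linarith
  · have hlim := tendsto_rpow_mul_exp_neg_mul_atTop_nhds_zero μ (1 / 2) (by norm_num)
    refine tendsto_of_tendsto_of_tendsto_of_le_of_le' tendsto_const_nhds hlim ?_ ?_
    · filter_upwards [eventually_gt_atTop 0] with u hu
      simp only [Pi.mul_apply]; positivity
    · filter_upwards [eventually_gt_atTop 0] with u hu
      have := kker_le0 (μ := μ + 1) hs.le hu
      unfold kker at this
      rw [add_sub_cancel_right] at this
      simp only [Pi.mul_apply]
      linarith

lemma kk_zero {μ : ℝ} (hμ : 0 < μ) : kk μ 0 = 2 ^ (μ - 1) * Real.Gamma μ := by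
  unfold kk kker
  have h := Real.integral_rpow_mul_exp_neg_mul_Ioi (a := μ) (r := 1 / 2) hμ (by norm_num)
  have : (fun u : ℝ => 1 / 2 * u ^ (μ - 1) * rexp (-(u / 2) - (0:ℝ) ^ 2 / (2 * u))) =
    fun u => 1 / 2 * (u ^ (μ - 1) * Real.exp (-(1 / 2 * u))) := by
    funext u
    rw [mul_assoc]; congr 3; simp; ring
  rw [this, integral_const_mul, h, Real.rpow_sub (by norm_num), Real.rpow_one]
  norm_num
  ring

lemma kk_cont {μ : ℝ} (hμ : 0 < μ) : Continuous (kk μ) := by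
  refine continuous_of_dominated (μ := volume.restrict (Set.Ioi (0:ℝ)))
    (bound := fun u => (1 / 2) * (u ^ (μ - 1) * Real.exp (-(1 / 2) * u)))
    (fun z => (kker_meas μ _).aestronglyMeasurable) (fun z => ?_)
    ((gam_int hμ (by norm_num)).const_mul _) ?_
  · filter_upwards [ae_restrict_mem measurableSet_Ioi] with u hu
    rw [Real.norm_eq_abs, abs_of_pos (kker_pos μ _ hu)]
    exact kker_le0 (sq_nonneg z) hu
  · filter_upwards [ae_restrict_mem measurableSet_Ioi] with u hu
    unfold kker
    fun_prop



lemma besselK_aux (μ : ℝ) {y : ℝ} (hy : 0 < y) :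
    IntegrableOn (fun t => Real.exp (-y * Real.cosh t) * Real.cosh (μ * t)) (Set.Ioi 0) ∧
    kk μ y = y ^ μ * besselK μ y := by
  have hs : 0 < y ^ 2 := by positivity
  have himg : (fun s : ℝ => y * Real.exp s) '' Set.univ = Set.Ioi 0 := by
    ext u
    simp only [Set.image_univ, Set.mem_range, Set.mem_Ioi]
    constructor
    · rintro ⟨s, rfl⟩; positivity
    · intro hu
      refine ⟨Real.log (u / y), ?_⟩
      rw [Real.exp_log (by positivity)]; field_simp
  have hder : ∀ x ∈ (Set.univ : Set ℝ), HasDerivWithinAt (fun s : ℝ => y * Real.exp s)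
      (y * Real.exp x) Set.univ x := fun x _ =>
    ((Real.hasDerivAt_exp x).const_mul y).hasDerivWithinAt
  have hinj : Set.InjOn (fun s : ℝ => y * Real.exp s) Set.univ := by
    intro a _ b _ h
    simpa [hy.ne'] using h
  have e : ∀ x : ℝ, |y * Real.exp x| • kker μ (y ^ 2) (y * Real.exp x) =
      y ^ μ * ((1 / 2) * (Real.exp (-y * Real.cosh x) * Real.exp (μ * x))) := by
    intro x
    have hE := Real.exp_pos x
    rw [abs_of_pos (by positivity), smul_eq_mul]
    unfold kker
    rw [Real.mul_rpow hy.le hE.le, Real.rpow_sub hy, Real.rpow_sub hE, Real.rpow_one,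
      Real.rpow_one, ← Real.exp_mul]
    have e1 : -(y * Real.exp x / 2) - y ^ 2 / (2 * (y * Real.exp x)) = -y * Real.cosh x := by
      rw [Real.cosh_eq, Real.exp_neg]; field_simp; ring
    rw [e1, mul_comm x μ]
    field_simp
  have hIntg := (integrableOn_image_iff_integrableOn_abs_deriv_smul MeasurableSet.univ hder hinj
    (kker μ (y ^ 2))).1 (by rw [himg]; exact kker_int μ hs)
  have hval := integral_image_eq_integral_abs_deriv_smul MeasurableSet.univ hder hinj
    (kker μ (y ^ 2))
  rw [himg] at hval
  simp only [e] at hIntg hval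
  rw [integrableOn_univ] at hIntg
  rw [setIntegral_univ, integral_const_mul] at hval
  have hyμ : 0 < y ^ μ := Real.rpow_pos_of_pos hy _
  have hG : Integrable (fun x => (1 / 2) * (Real.exp (-y * Real.cosh x) * Real.exp (μ * x))) := by
    have := hIntg.const_mul (y ^ μ)⁻¹
    refine this.congr (Eventually.of_forall fun x => ?_)
    simp only; field_simp
  set G : ℝ → ℝ := fun x => (1 / 2) * (Real.exp (-y * Real.cosh x) * Real.exp (μ * x)) with hGd
  have hsum : ∀ t, G t + G (-t) = Real.exp (-y * Real.cosh t) * Real.cosh (μ * t) := by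
    intro t
    simp only [hGd, Real.cosh_neg, mul_neg]
    rw [Real.cosh_eq (μ * t)]; ring
  have hI : IntegrableOn (fun t => G t + G (-t)) (Set.Ioi 0) :=
    hG.integrableOn.add hG.comp_neg.integrableOn
  refine ⟨?_, ?_⟩
  · simpa only [hsum] using hI
  · unfold kk besselK
    rw [hval]
    congr 1
    rw [← intervalIntegral.integral_Iic_add_Ioi (b := 0) hG.integrableOn hG.integrableOn]
    have := integral_comp_neg_Ioi 0 G
    rw [neg_zero] at this
    rw [← this, add_comm, ← integral_add hG.integrableOn hG.comp_neg.integrableOn]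
    simp only [hsum]

lemma kk_eq (μ : ℝ) {y : ℝ} (hy : 0 < y) : kk μ y = y ^ μ * besselK μ y := (besselK_aux μ hy).2

lemma kk_le {ν y : ℝ} (hν : -1/2 ≤ ν) (hy : 0 < y) : y * kk ν y ≤ kk (ν + 1) y := by
  rw [kk_eq ν hy, kk_eq (ν + 1) hy, Real.rpow_add hy, Real.rpow_one]
  have : besselK ν y ≤ besselK (ν + 1) y := by
    refine setIntegral_mono_on (besselK_aux ν hy).1 (besselK_aux (ν + 1) hy).1 measurableSet_Ioi ?_
    intro t ht
    have ht : 0 < t := ht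
    refine mul_le_mul_of_nonneg_left ?_ (Real.exp_pos _).le
    rw [Real.cosh_le_cosh, abs_mul, abs_mul]
    refine mul_le_mul_of_nonneg_right ?_ (abs_nonneg _)
    rw [abs_of_nonneg (by linarith : 0 ≤ ν + 1), abs_le]
    constructor <;> linarith
  have hp := Real.rpow_pos_of_pos hy ν
  calc _ = y ^ ν * y * besselK ν y := by ring
    _ ≤ _ := by gcongr

lemma kk_decay (μ : ℝ) {y : ℝ} (hy : 1 ≤ y) :
    kk μ y ≤ (Real.exp 1 * besselK μ 1) * (y ^ μ * Real.exp (-y)) := by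
  have hy0 : 0 < y := by linarith
  rw [kk_eq μ hy0]
  have : besselK μ y ≤ Real.exp (1 - y) * besselK μ 1 := by
    unfold besselK
    rw [← integral_const_mul]
    refine setIntegral_mono_on (besselK_aux μ hy0).1
      ((besselK_aux μ one_pos).1.const_mul _) measurableSet_Ioi ?_
    intro t ht
    rw [← mul_assoc, ← Real.exp_add]
    refine mul_le_mul_of_nonneg_right ?_ (Real.cosh_pos _).le
    rw [Real.exp_le_exp]
    nlinarith [Real.one_le_cosh t]
  have hp := Real.rpow_pos_of_pos hy0 μ
  calc _ ≤ y ^ μ * (Real.exp (1 - y) * besselK μ 1) := by gcongr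
    _ = _ := by rw [sub_eq_add_neg, Real.exp_add]; ring

/-! Laplace-type transform -/

noncomputable def NN (μ b : ℝ) : ℝ :=
  Real.sqrt (2 * Real.pi) / 2 * ((2 / (1 - b ^ 2)) ^ (μ + 1 / 2) * Real.Gamma (μ + 1 / 2))

lemma gauss_shift {b u : ℝ} (hu : 0 < u) :
    Integrable (fun t : ℝ => Real.exp (b * t - t ^ 2 / (2 * u))) ∧
    ∫ t : ℝ, Real.exp (b * t - t ^ 2 / (2 * u)) =
      Real.sqrt (2 * Real.pi) * u ^ (1 / 2 : ℝ) * Real.exp (b ^ 2 * u / 2) := by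
  have e : ∀ t : ℝ, Real.exp (b * t - t ^ 2 / (2 * u)) =
      Real.exp (b ^ 2 * u / 2) * Real.exp (-(1 / (2 * u)) * (t - b * u) ^ 2) := by
    intro t
    rw [← Real.exp_add]; congr 1; field_simp; ring
  simp only [e]
  refine ⟨?_, ?_⟩
  · exact ((integrable_exp_neg_mul_sq (b := 1 / (2 * u)) (by positivity)).comp_sub_right
      (b * u)).const_mul _
  · rw [integral_const_mul, integral_sub_right_eq_self (μ := volume)
      (fun t => Real.exp (-(1 / (2 * u)) * t ^ 2)) (b * u), integral_gaussian]
    rw [← Real.sqrt_eq_rpow, ← Real.sqrt_mul (by positivity), mul_comm]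
    congr 2
    field_simp

lemma kk_laplace {μ b : ℝ} (hμ : 0 < μ + 1 / 2) (hb : |b| < 1) :
    Integrable (fun t => Real.exp (b * t) * kk μ t) ∧
    ∫ t, Real.exp (b * t) * kk μ t = NN μ b := by
  have hq : 0 < 1 - b ^ 2 := by rw [← sq_abs]; nlinarith [abs_nonneg b]
  set F : ℝ → ℝ → ℝ := fun t u => Real.exp (b * t) * kker μ (t ^ 2) u with hF
  have e : ∀ u, 0 < u → ∀ t, F t u = ((1 / 2) * u ^ (μ - 1) * Real.exp (-(u / 2))) *
      Real.exp (b * t - t ^ 2 / (2 * u)) := by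
    intro u hu t
    simp only [hF, kker]
    rw [sub_eq_add_neg (-(u / 2)), Real.exp_add, sub_eq_add_neg (b * t), Real.exp_add]
    ring
  have hinner : ∀ u, 0 < u → ∫ t, F t u = Real.sqrt (2 * Real.pi) / 2 *
      (u ^ (μ + 1 / 2 - 1) * Real.exp (-((1 - b ^ 2) / 2) * u)) := by
    intro u hu
    simp only [e u hu]
    rw [integral_const_mul, (gauss_shift hu).2,
      show μ + 1 / 2 - 1 = (μ - 1) + 1 / 2 by ring, Real.rpow_add hu,
      show -((1 - b ^ 2) / 2) * u = -(u / 2) + b ^ 2 * u / 2 by ring, Real.exp_add]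
    ring
  have hmeas : Measurable (Function.uncurry F) := by
    simp only [hF, kker, Function.uncurry_def]
    fun_prop
  have hIntg : Integrable (Function.uncurry F)
      ((volume : Measure ℝ).prod (volume.restrict (Set.Ioi (0:ℝ)))) := by
    rw [integrable_prod_iff' hmeas.aestronglyMeasurable]
    refine ⟨?_, ?_⟩
    · filter_upwards [ae_restrict_mem measurableSet_Ioi] with u hu
      simp only [Function.uncurry_apply_pair, e u hu]
      exact (gauss_shift hu).1.const_mul _
    · have h := (gam_int (a := μ + 1 / 2) hμ (q := (1 - b ^ 2) / 2) (by positivity)).const_mul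
        (Real.sqrt (2 * Real.pi) / 2)
      refine Integrable.congr h ?_
      filter_upwards [ae_restrict_mem measurableSet_Ioi] with u hu
      rw [← hinner u hu]
      refine integral_congr_ae (Eventually.of_forall fun t => ?_)
      simp only [Function.uncurry_apply_pair]
      rw [Real.norm_eq_abs, abs_of_pos]
      exact mul_pos (Real.exp_pos _) (kker_pos _ _ hu)
  have hk : ∀ t, ∫ u in Set.Ioi (0:ℝ), F t u = Real.exp (b * t) * kk μ t := by
    intro t
    simp only [hF]
    rw [integral_const_mul]; rfl
  refine ⟨?_, ?_⟩
  · have := hIntg.integral_prod_left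
    simpa only [Function.uncurry_apply_pair, hk] using this
  · have := integral_integral_swap hIntg
    simp only [hk] at this
    rw [this, setIntegral_congr_fun measurableSet_Ioi (fun u hu => hinner u hu),
      integral_const_mul]
    unfold NN
    congr 1
    have h := Real.integral_rpow_mul_exp_neg_mul_Ioi (a := μ + 1 / 2) (r := (1 - b ^ 2) / 2) hμ
      (by positivity)
    simp only [neg_mul]
    rw [h, one_div_div]


noncomputable def ac (ν : ℝ) (k : ℕ) : ℝ :=
  (2:ℝ) ^ (-ν) * ((4:ℝ)⁻¹) ^ k / (Real.Gamma (ν + k + 1) * (Nat.factorial k))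

noncomputable def JJ (ν z : ℝ) : ℝ := ∑' k : ℕ, ac ν k * z ^ k

/-- `y^(-ν) I_ν(y)` -/
noncomputable def ii (ν y : ℝ) : ℝ := JJ ν (y ^ 2)

lemma ac_pos {ν : ℝ} (hν : -1/2 < ν) (k : ℕ) : 0 < ac ν k := by
  have : 0 < Real.Gamma (ν + k + 1) := Real.Gamma_pos_of_pos (by
    have : (0:ℝ) ≤ k := Nat.cast_nonneg k
    linarith)
  unfold ac; positivity

lemma ac_succ {ν : ℝ} (hν : -1/2 < ν) (k : ℕ) :
    ac ν (k + 1) * (4 * (ν + k + 1) * (k + 1)) = ac ν k := by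
  have hk : (0:ℝ) ≤ k := Nat.cast_nonneg k
  have h1 : Real.Gamma (ν + k + 1 + 1) = (ν + k + 1) * Real.Gamma (ν + k + 1) :=
    Real.Gamma_add_one (by linarith)
  have hG : 0 < Real.Gamma (ν + k + 1) := Real.Gamma_pos_of_pos (by linarith)
  have h3 : 0 < ν + k + 1 := by linarith
  unfold ac
  rw [Nat.factorial_succ]
  push_cast
  rw [show ν + ((k:ℝ) + 1) + 1 = ν + k + 1 + 1 by ring, h1, pow_succ]
  field_simp

lemma ac_shift {ν : ℝ} (hν : -1/2 < ν) (k : ℕ) :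
    ac ν (k + 1) * (k + 1) = 1 / 2 * ac (ν + 1) k := by
  have hk : (0:ℝ) ≤ k := Nat.cast_nonneg k
  have hG : 0 < Real.Gamma (ν + k + 1 + 1) := Real.Gamma_pos_of_pos (by linarith)
  unfold ac
  rw [Nat.factorial_succ]
  push_cast
  rw [show ν + ((k:ℝ) + 1) + 1 = ν + k + 1 + 1 by ring,
    show ν + 1 + (k:ℝ) + 1 = ν + k + 1 + 1 by ring, pow_succ, neg_add,
    Real.rpow_add (by norm_num), Real.rpow_neg_one]
  field_simp
  norm_num

lemma ac_le {ν : ℝ} (hν : -1/2 < ν) (k : ℕ) : ac ν k ≤ ac ν 0 / (Nat.factorial k) := by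
  induction k with
  | zero => simp
  | succ k ih =>
    have h := ac_succ hν k
    have hk : (0:ℝ) ≤ k := Nat.cast_nonneg k
    have hp := ac_pos hν (k + 1)
    have h2 : ac ν (k + 1) * (k + 1) ≤ ac ν k := by
      rw [← h]
      refine mul_le_mul_of_nonneg_left ?_ hp.le
      nlinarith
    have hf : (0:ℝ) < Nat.factorial k := by positivity
    rw [le_div_iff₀ hf] at ih
    rw [Nat.factorial_succ]
    push_cast
    rw [le_div_iff₀ (by positivity)]
    nlinarith

lemma ac_summable {ν : ℝ} (hν : -1/2 < ν) (z : ℝ) : Summable (fun k => ac ν k * z ^ k) := by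
  refine Summable.of_norm_bounded (g := fun k => ac ν 0 * (|z| ^ k / (Nat.factorial k)))
    ((Real.summable_pow_div_factorial |z|).mul_left _) ?_
  intro k
  rw [Real.norm_eq_abs, abs_mul, abs_pow, abs_of_pos (ac_pos hν k)]
  have := ac_le hν k
  calc _ ≤ ac ν 0 / (Nat.factorial k) * |z| ^ k := by gcongr
    _ = _ := by ring

lemma JJ_deriv {ν : ℝ} (hν : -1/2 < ν) (z : ℝ) : HasDerivAt (JJ ν) (1 / 2 * JJ (ν + 1) z) z := by
  set R := |z| + 1 with hR
  have hu : Summable (fun k : ℕ => ac ν 0 * ((k:ℝ) * R ^ (k - 1) / (Nat.factorial k))) := by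
    refine Summable.mul_left _ ?_
    rw [← summable_nat_add_iff 1]
    refine (Real.summable_pow_div_factorial R).congr (fun k => ?_)
    rw [Nat.factorial_succ, Nat.add_sub_cancel]
    push_cast
    field_simp
  have h := hasDerivAt_tsum_of_isPreconnected (g := fun (k : ℕ) (z : ℝ) => ac ν k * z ^ k)
    (g' := fun (k : ℕ) (z : ℝ) => ac ν k * ((k:ℝ) * z ^ (k - 1))) (t := Metric.ball 0 R)
    (y₀ := 0) (y := z) hu Metric.isOpen_ball (convex_ball (0:ℝ) R).isPreconnected
    (fun k w _ => (hasDerivAt_pow k w).const_mul _) ?_ (by simp [hR]; positivity)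
    (ac_summable hν 0) (by simp [hR])
  · refine h.congr_deriv ?_
    have hs : Summable (fun k : ℕ => ac ν k * ((k:ℝ) * z ^ (k - 1))) := by
      rw [← summable_nat_add_iff 1]
      refine ((ac_summable (ν := ν + 1) (by linarith) z).mul_left (1 / 2)).congr (fun k => ?_)
      have := ac_shift hν k
      rw [Nat.add_sub_cancel]
      push_cast
      rw [← mul_assoc, ← this]; ring
    rw [hs.tsum_eq_zero_add]
    simp only [Nat.cast_zero, zero_mul, mul_zero, zero_add]
    unfold JJ
    rw [← tsum_mul_left]
    refine tsum_congr (fun k => ?_)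
    have := ac_shift hν k
    rw [Nat.add_sub_cancel]
    push_cast
    rw [← mul_assoc, ← mul_assoc, ← this]
  · intro k w hw
    have hw : |w| < R := by simpa using hw
    rw [Real.norm_eq_abs, abs_mul, abs_mul, abs_pow, abs_of_pos (ac_pos hν k), Nat.abs_cast]
    have := ac_le hν k
    have h0 := (ac_pos hν 0).le
    calc _ ≤ ac ν 0 / (Nat.factorial k) * ((k:ℝ) * R ^ (k - 1)) := by gcongr
      _ = _ := by ring

lemma JJ_rec {ν : ℝ} (hν : -1/2 < ν) (z : ℝ) :
    JJ ν z = (2 * ν + 2) * JJ (ν + 1) z + z * JJ (ν + 2) z := by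
  have s0 := ac_summable hν z
  have s1 := ac_summable (ν := ν + 1) (by linarith) z
  have s2 := ac_summable (ν := ν + 2) (by linarith) z
  have hstep : ∀ k : ℕ, ac ν k = 2 * (ν + k + 1) * ac (ν + 1) k := by
    intro k
    have h1 := ac_succ hν k
    have h2 := ac_shift hν k
    rw [← h1]; linear_combination (4 * (ν + k + 1)) * h2
  unfold JJ
  rw [s0.tsum_eq_zero_add, s1.tsum_eq_zero_add, ← tsum_mul_left]
  have s0' := (summable_nat_add_iff 1).2 s0
  have s1' := (summable_nat_add_iff 1).2 s1
  have : ∑' k : ℕ, ac ν (k + 1) * z ^ (k + 1) =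
      (2 * ν + 2) * (∑' k : ℕ, ac (ν + 1) (k + 1) * z ^ (k + 1)) +
      ∑' k : ℕ, z * (ac (ν + 2) k * z ^ k) := by
    rw [← tsum_mul_left, ← (s1'.mul_left _).tsum_add (s2.mul_left z)]
    refine tsum_congr (fun k => ?_)
    have h1 := hstep (k + 1)
    have h2 := ac_shift (ν := ν + 1) (by linarith) k
    rw [show ν + 1 + 1 = ν + 2 by ring] at h2
    rw [h1, pow_succ]
    push_cast
    linear_combination 2 * z ^ k * z * h2
  rw [this, hstep 0]
  push_cast
  ring

lemma JJ_zero (ν : ℝ) : JJ ν 0 = (2:ℝ) ^ (-ν) / Real.Gamma (ν + 1) := by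
  unfold JJ
  rw [tsum_eq_single 0 (fun k hk => by simp [hk])]
  simp [ac]

lemma JJ_pos {ν : ℝ} (hν : -1/2 < ν) {z : ℝ} (hz : 0 ≤ z) : 0 < JJ ν z := by
  unfold JJ
  refine (ac_summable hν z).tsum_pos (fun k => ?_) 0 ?_
  · have := (ac_pos hν k).le; positivity
  · simpa using ac_pos hν 0

lemma ii_deriv {ν : ℝ} (hν : -1/2 < ν) (y : ℝ) : HasDerivAt (ii ν) (y * ii (ν + 1) y) y := by
  have h := (JJ_deriv hν (y ^ 2)).comp y (hasDerivAt_pow 2 y)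
  refine h.congr_deriv ?_
  unfold ii
  push_cast
  ring

lemma besselI_eq (ν : ℝ) {y : ℝ} (hy : 0 < y) : besselI ν y = y ^ ν * ii ν y := by
  unfold besselI ii JJ
  rw [← tsum_mul_left]
  refine tsum_congr (fun k => ?_)
  unfold ac
  rw [Real.rpow_add (by positivity), Real.div_rpow hy.le (by norm_num),
    show (2:ℝ) * (k:ℝ) = ((2 * k : ℕ) : ℝ) by push_cast; ring, Real.rpow_natCast, pow_mul,
    div_pow, Real.rpow_neg (by norm_num), div_eq_mul_inv (y ^ 2), mul_pow,
    show ((2:ℝ) ^ 2)⁻¹ = 4⁻¹ by norm_num]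
  ring

/-! The concrete system -/

noncomputable def cc (r : ℝ) : ℝ := (2:ℝ) ^ (-((r - 1) / 2)) / Real.Gamma ((r - 1) / 2 + 1)
noncomputable def SS (r : ℝ) : ℝ :=
  Real.sqrt Real.pi * Real.Gamma (r / 2) / Real.Gamma ((r - 1) / 2 + 1)

lemma cc_pos {r : ℝ} (hr : 0 < r) : 0 < cc r := by
  have : 0 < Real.Gamma ((r - 1) / 2 + 1) := Real.Gamma_pos_of_pos (by linarith)
  unfold cc; positivity

lemma SS_pos {r : ℝ} (hr : 0 < r) : 0 < SS r := by
  have : 0 < Real.Gamma ((r - 1) / 2 + 1) := Real.Gamma_pos_of_pos (by linarith)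
  have : 0 < Real.Gamma (r / 2) := Real.Gamma_pos_of_pos (by linarith)
  unfold SS; positivity

lemma cNN {r b : ℝ} (hr : 0 < r) (hb : |b| < 1) :
    cc r * NN ((r - 1) / 2) b = SS r * (1 - b ^ 2) ^ (-(r / 2)) := by
  have hq : 0 < 1 - b ^ 2 := by rw [← sq_abs]; nlinarith [abs_nonneg b]
  have hG : 0 < Real.Gamma ((r - 1) / 2 + 1) := Real.Gamma_pos_of_pos (by linarith)
  unfold cc NN SS
  rw [show (r - 1) / 2 + 1 / 2 = r / 2 by ring, Real.div_rpow (by norm_num) hq.le,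
    Real.rpow_neg hq.le, show -((r - 1) / 2) = -(r / 2) + 1 / 2 by ring,
    Real.rpow_add (by norm_num), Real.rpow_neg (by norm_num), ← Real.sqrt_eq_rpow,
    Real.sqrt_mul (by norm_num)]
  have h2 : Real.sqrt 2 * Real.sqrt 2 = 2 := Real.mul_self_sqrt (by norm_num)
  have : 0 < (2:ℝ) ^ (r / 2) := by positivity
  have : 0 < (1 - b ^ 2) ^ (r / 2) := by positivity
  generalize Real.Gamma ((r - 1) / 2 + 1) = g at *
  field_simp
  linear_combination h2

lemma NN_succ {r b : ℝ} (hr : 0 < r) (hb : |b| < 1) :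
    NN ((r - 1) / 2 + 1) b = NN ((r - 1) / 2) b * (r / (1 - b ^ 2)) := by
  have hq : 0 < 1 - b ^ 2 := by rw [← sq_abs]; nlinarith [abs_nonneg b]
  unfold NN
  rw [show (r - 1) / 2 + 1 + 1 / 2 = r / 2 + 1 by ring, show (r - 1) / 2 + 1 / 2 = r / 2 by ring,
    Real.rpow_add (by positivity), Real.rpow_one, Real.Gamma_add_one (by positivity)]
  field_simp

lemma NN_pos {r b : ℝ} (hr : 0 < r) (hb : |b| < 1) : 0 < NN ((r - 1) / 2) b := by
  have hq : 0 < 1 - b ^ 2 := by rw [← sq_abs]; nlinarith [abs_nonneg b]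
  have hG : 0 < Real.Gamma ((r - 1) / 2 + 1 / 2) := Real.Gamma_pos_of_pos (by linarith)
  unfold NN
  positivity

/-- log-convexity: `Γ(x+1/2)^2 ≤ Γ(x)Γ(x+1)` -/
lemma gamma_half_sq {x : ℝ} (hx : 0 < x) :
    Real.Gamma (x + 1 / 2) ^ 2 ≤ Real.Gamma x * Real.Gamma (x + 1) := by
  have hl := Real.Gamma_mul_add_mul_le_rpow_Gamma_mul_rpow_Gamma (s := x)
    (t := x + 1) (a := 1/2) (b := 1/2) hx (by linarith) (by norm_num) (by norm_num)
    (by norm_num)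
  have e2 : (1/2 : ℝ) * x + 1/2 * (x + 1) = x + 1 / 2 := by ring
  have p1 : 0 < Real.Gamma x := Real.Gamma_pos_of_pos hx
  have p2 : 0 < Real.Gamma (x + 1 / 2) := Real.Gamma_pos_of_pos (by linarith)
  rw [e2, ← Real.sqrt_eq_rpow, ← Real.sqrt_eq_rpow, ← Real.sqrt_mul p1.le,
    Real.le_sqrt' p2] at hl
  exact hl

lemma SS_le {r : ℝ} (hr : 0 < r) : SS r ≤ Real.sqrt (2 * Real.pi * (r + 1)) / r := by
  have hG : 0 < Real.Gamma ((r - 1) / 2 + 1) := Real.Gamma_pos_of_pos (by linarith)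
  have hG2 : 0 < Real.Gamma (r / 2) := Real.Gamma_pos_of_pos (by linarith)
  have h := gamma_half_sq (x := (r - 1) / 2 + 1) (by linarith)
  rw [Real.Gamma_add_one (s := (r - 1) / 2 + 1) (by linarith),
    show (r - 1) / 2 + 1 + 1 / 2 = r / 2 + 1 by ring,
    Real.Gamma_add_one (s := r / 2) (by linarith)] at h
  unfold SS
  rw [div_le_div_iff₀ hG hr]
  have : Real.sqrt (2 * Real.pi * (r + 1)) = Real.sqrt Real.pi * Real.sqrt (2 * (r + 1)) := by
    rw [← Real.sqrt_mul Real.pi_pos.le]; congr 1; ring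
  rw [this, mul_assoc, mul_assoc]
  refine mul_le_mul_of_nonneg_left ?_ (Real.sqrt_nonneg _)
  refine le_of_sq_le_sq ?_ (by positivity)
  rw [mul_pow (Real.sqrt _), Real.sq_sqrt (by positivity)]
  nlinarith

lemma SS_ge {r : ℝ} (hr : 0 < r) : 2 ≤ Real.sqrt (2 * r) * SS r := by
  have hG : 0 < Real.Gamma ((r - 1) / 2 + 1) := Real.Gamma_pos_of_pos (by linarith)
  have hG2 : 0 < Real.Gamma (r / 2) := Real.Gamma_pos_of_pos (by linarith)
  have h := gamma_half_sq (x := r / 2) (by linarith)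
  rw [Real.Gamma_add_one (s := r / 2) (by linarith),
    show r / 2 + 1 / 2 = (r - 1) / 2 + 1 by ring] at h
  unfold SS
  rw [mul_div_assoc', le_div_iff₀ hG]
  refine le_of_sq_le_sq ?_ (by positivity)
  rw [mul_pow, mul_pow, mul_pow, Real.sq_sqrt (by positivity), Real.sq_sqrt Real.pi_pos.le]
  have : 2 * Real.Gamma ((r - 1) / 2 + 1) ^ 2 ≤ r * Real.Gamma (r / 2) ^ 2 := by nlinarith
  have h0 : 0 ≤ r * Real.Gamma (r / 2) ^ 2 := by positivity
  nlinarith [Real.pi_gt_three]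

lemma bsys {r : ℝ} (hr : 0 < r) :
    BSys r (kk ((r - 1) / 2)) (kk ((r - 1) / 2 + 1)) (ii ((r - 1) / 2)) (ii ((r - 1) / 2 + 1))
      (cc r) (SS r) := by
  have hν : -1 / 2 < (r - 1) / 2 := by linarith
  have hcc := cc_pos hr
  have lap0 := fun (b : ℝ) (hb : |b| < 1) =>
    kk_laplace (μ := (r - 1) / 2) (b := b) (by linarith) hb
  have lap1 := fun (b : ℝ) (hb : |b| < 1) =>
    kk_laplace (μ := (r - 1) / 2 + 1) (b := b) (by linarith) hb
  have hrec := fun y (hy : 0 < y) => kk_rec ((r - 1) / 2) (y := y) hy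
  constructor
  · exact hr
  · exact hcc
  · unfold ii cc
    rw [zero_pow two_ne_zero, JJ_zero]
  · exact fun y hy => kk_pos _ hy.ne'
  · exact fun y hy => kk_pos _ hy.ne'
  · exact fun y _ => JJ_pos hν (sq_nonneg y)
  · exact fun y _ => JJ_pos (by linarith) (sq_nonneg y)
  · intro y hy
    refine (kk_hasDerivAt _ hy).congr_deriv ?_
    rw [hrec y hy]
    field_simp
    ring
  · intro y hy
    refine (kk_hasDerivAt _ hy).congr_deriv ?_
    rw [add_sub_cancel_right]
  · exact fun y => ii_deriv hν y
  · intro y hy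
    refine (ii_deriv (by linarith) y).congr_deriv ?_
    have := JJ_rec hν (y ^ 2)
    unfold ii
    rw [this, show (r - 1) / 2 + 1 + 1 = (r - 1) / 2 + 2 by ring]
    field_simp
    ring
  · exact continuous_iff_continuousAt.2 fun y => (ii_deriv (by linarith) y).continuousAt
  · exact fun y hy => kk_le hν.le hy
  · intro y hy
    rw [hrec y hy]
    have := kk_pos ((r - 1) / 2 - 1) hy.ne'
    nlinarith [mul_pos (pow_pos hy 2) this]
  · have h := ((kk_cont (μ := (r - 1) / 2 + 1) (by linarith)).tendsto 0).mono_left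
      (nhdsWithin_le_nhds (s := Set.Ioi (0:ℝ)))
    rw [kk_zero (by linarith)] at h
    convert h using 2
    unfold cc
    rw [add_sub_cancel_right, Real.rpow_neg (by norm_num), inv_div, div_inv_eq_mul, mul_comm]
  · refine ⟨Real.exp 1 * besselK ((r - 1) / 2 + 1) 1, fun y hy => ?_⟩
    have := kk_decay ((r - 1) / 2 + 1) hy
    rwa [show (r - 1) / 2 + 1 = (r + 1) / 2 by ring] at this ⊢
  · exact fun b hb => (lap0 b hb).1.integrableOn
  · exact fun b hb => (lap1 b hb).1.integrableOn
  · intro b hb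
    rw [← cNN hr hb, ← (lap0 b hb).2]
    refine mul_le_mul_of_nonneg_left ?_ hcc.le
    exact setIntegral_le_integral (lap0 b hb).1 (Eventually.of_forall fun t =>
      mul_nonneg (Real.exp_pos _).le (kk_nonneg _ _))
  · intro b hb
    have hq : 0 < 1 - b ^ 2 := by rw [← sq_abs]; nlinarith [abs_nonneg b]
    have e : SS r * r * (1 - b ^ 2) ^ (-(r / 2) - 1) = cc r * NN ((r - 1) / 2 + 1) b := by
      rw [NN_succ hr hb, ← mul_assoc, cNN hr hb, Real.rpow_sub hq, Real.rpow_one]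
      ring
    rw [e, ← (lap1 b hb).2]
    refine mul_le_mul_of_nonneg_left ?_ hcc.le
    exact setIntegral_le_integral (lap1 b hb).1 (Eventually.of_forall fun t =>
      mul_nonneg (Real.exp_pos _).le (kk_nonneg _ _))
  · have h := (lap0 0 (by simp)).2
    have h2 := cNN (b := 0) hr (by simp)
    rw [← h] at h2
    simp only [zero_mul, Real.exp_zero, one_mul] at h2
    have h3 := integral_comp_abs (f := kk ((r - 1) / 2))
    simp only [kk_abs] at h3
    rw [h3] at h2
    norm_num at h2
    linarith
  · exact SS_le hr


lemma q_pos {b : ℝ} (hb : |b| < 1) : 0 < 1 - b ^ 2 := by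
  rw [← sq_abs]; nlinarith [abs_nonneg b]

/-- absolute first moment -/
lemma abs_moment {r b : ℝ} (hr : 0 < r) (hb : |b| < 1) :
    Integrable (fun v => |v| * (Real.exp (b * v) * kk ((r - 1) / 2) v)) ∧
    (∫ v, |v| * (Real.exp (b * v) * kk ((r - 1) / 2) v)) * (1 - b ^ 2) ≤
      (Real.sqrt (2 * r) + r) * NN ((r - 1) / 2) b := by
  have B := bsys hr
  have hb' : |-b| < 1 := by rwa [abs_neg]
  have hq := q_pos hb
  set ν := (r - 1) / 2 with hν
  set G : ℝ → ℝ := fun v => |v| * (Real.exp (b * v) * kk ν v) with hG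
  have g1 : IntegrableOn G (Set.Ioi 0) := by
    refine (B.intT hb).congr_fun ?_ measurableSet_Ioi
    intro t ht
    have ht : 0 < t := ht
    simp only [hG, abs_of_pos ht]; ring
  have g2 : IntegrableOn (fun v => G (-v)) (Set.Ioi 0) := by
    refine (B.intT hb').congr_fun ?_ measurableSet_Ioi
    intro t ht
    have ht : 0 < t := ht
    simp only [hG, abs_neg, abs_of_pos ht, kk_neg]
    rw [show b * -t = -b * t by ring]; ring
  have g3 : IntegrableOn G (Set.Iic 0) := by
    have := integrableOn_Iic_iff_integrableOn_Iio (f := G) (b := 0) (μ := volume)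
    rw [this]
    have h := (integrable_indicator_iff measurableSet_Ioi).2 g2
    have h2 := h.comp_neg
    rw [← integrable_indicator_iff measurableSet_Iio]
    refine h2.congr (Eventually.of_forall fun t => ?_)
    by_cases ht : t < 0
    · simp [Set.indicator, ht]
    · simp [Set.indicator, ht]
  have v1 : ∫ v in Set.Ioi 0, G v = (cc r)⁻¹ + b * ∫ t in Set.Ioi 0, Real.exp (b * t) * kk (ν + 1) t := by
    rw [← B.K2_zero hb]
    refine setIntegral_congr_fun measurableSet_Ioi ?_
    intro t ht
    have ht : 0 < t := ht
    simp only [hG, abs_of_pos ht]; ring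
  have v2 : ∫ v in Set.Iic 0, G v =
      (cc r)⁻¹ + -b * ∫ t in Set.Ioi 0, Real.exp (-b * t) * kk (ν + 1) t := by
    have := integral_comp_neg_Ioi 0 G
    rw [neg_zero] at this
    rw [← B.K2_zero hb', ← this]
    refine setIntegral_congr_fun measurableSet_Ioi ?_
    intro t ht
    have ht : 0 < t := ht
    simp only [hG, abs_neg, abs_of_pos ht, kk_neg]
    rw [show b * -t = -b * t by ring]; ring
  have lap1 := kk_laplace (μ := ν + 1) (b := b) (by rw [hν]; linarith) hb
  have hsum : (∫ t in Set.Ioi 0, Real.exp (b * t) * kk (ν + 1) t) +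
      (∫ t in Set.Ioi 0, Real.exp (-b * t) * kk (ν + 1) t) = NN (ν + 1) b := by
    rw [← lap1.2, ← intervalIntegral.integral_Iic_add_Ioi (b := 0) lap1.1.integrableOn
      lap1.1.integrableOn, add_comm]
    congr 1
    have := integral_comp_neg_Ioi 0 (fun t => Real.exp (b * t) * kk (ν + 1) t)
    rw [neg_zero] at this
    rw [← this]
    refine setIntegral_congr_fun measurableSet_Ioi ?_
    intro t _
    simp only [kk_neg]
    rw [show b * -t = -b * t by ring]
  have n1 := B.K_nonneg1 (b := b) (y := 0) le_rfl
  have n2 := B.K_nonneg1 (b := -b) (y := 0) le_rfl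
  refine ⟨?_, ?_⟩
  · rw [← integrableOn_univ, ← Set.Iic_union_Ioi (a := (0:ℝ))]
    exact g3.union g1
  · rw [← intervalIntegral.integral_Iic_add_Ioi g3 g1, v1, v2]
    set X := ∫ t in Set.Ioi 0, Real.exp (b * t) * kk (ν + 1) t
    set Y := ∫ t in Set.Ioi 0, Real.exp (-b * t) * kk (ν + 1) t
    have hXY : b * X + -b * Y ≤ X + Y := by
      have := abs_lt.1 hb
      nlinarith
    have hN := NN_succ hr hb
    rw [← hν] at hN
    have hc := cNN hr hb
    rw [← hν] at hc
    have hcp := cc_pos hr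
    have hNp := NN_pos hr hb
    rw [← hν] at hNp
    have hS := SS_ge hr
    have hSp := SS_pos hr
    have hZ : 1 ≤ (1 - b ^ 2) ^ (-(r / 2)) := by
      refine Real.one_le_rpow_of_pos_of_le_one_of_nonpos hq ?_ (by linarith)
      nlinarith [sq_nonneg b]
    have h1 : 2 ≤ Real.sqrt (2 * r) * (cc r * NN ν b) := by
      rw [hc]
      have : Real.sqrt (2 * r) * SS r ≤ Real.sqrt (2 * r) * (SS r * (1 - b ^ 2) ^ (-(r / 2))) := by
        gcongr
        exact le_mul_of_one_le_right hSp.le hZ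
      linarith
    have h2 : 2 * (cc r)⁻¹ ≤ Real.sqrt (2 * r) * NN ν b := by
      rw [← div_eq_mul_inv, div_le_iff₀ hcp]; linarith
    have h3 : 2 * (cc r)⁻¹ * (1 - b ^ 2) ≤ Real.sqrt (2 * r) * NN ν b := by
      refine le_trans ?_ h2
      refine mul_le_of_le_one_right (by positivity) ?_
      nlinarith [sq_nonneg b]
    have h4 : NN (ν + 1) b * (1 - b ^ 2) = r * NN ν b := by
      rw [hN]; field_simp
    have h5 : (b * X + -b * Y) * (1 - b ^ 2) ≤ r * NN ν b := by
      rw [← h4, ← hsum]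
      exact mul_le_mul_of_nonneg_right hXY hq.le
    nlinarith

lemma centre {r b ℓ : ℝ} (hr : 0 < r) (hb : |b| < 1) {g : ℝ → ℝ} (hl : 0 ≤ ℓ)
    (hg : ∀ u v, |g u - g v| ≤ ℓ * |u - v|) :
    ∃ M, 0 ≤ M ∧ M * (1 - b ^ 2) ≤ Real.sqrt (2 * r) + r ∧
      ∀ m, m = (∫ v, g v * (Real.exp (b * v) * kk ((r - 1) / 2) v)) / NN ((r - 1) / 2) b →
      (∀ u, |g u - m| ≤ ℓ * (|u| + M)) ∧
      (Integrable (fun v => Real.exp (b * v) * kk ((r - 1) / 2) v * (g v - m))) ∧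
      (∫ v, Real.exp (b * v) * kk ((r - 1) / 2) v * (g v - m)) = 0 := by
  have hlap := kk_laplace (μ := (r - 1) / 2) (b := b) (by linarith) hb
  obtain ⟨hmi, hmv⟩ := abs_moment hr hb
  have hN := NN_pos hr hb
  set N := NN ((r - 1) / 2) b with hNd
  set W : ℝ → ℝ := fun v => Real.exp (b * v) * kk ((r - 1) / 2) v with hW
  have hW0 : ∀ v, 0 ≤ W v := fun v => mul_nonneg (Real.exp_pos _).le (kk_nonneg _ _)
  have hgc : Continuous g := by
    have : LipschitzWith ⟨ℓ, hl⟩ g := by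
      refine LipschitzWith.of_dist_le_mul fun x y => ?_
      rw [Real.dist_eq, Real.dist_eq]; exact hg x y
    exact this.continuous
  have hgi : Integrable (fun v => g v * W v) := by
    have h1 : Integrable (fun v => ℓ * (|v| * W v) + |g 0| * W v) :=
      (hmi.const_mul ℓ).add (hlap.1.const_mul _)
    refine Integrable.mono' h1 (hgc.aestronglyMeasurable.mul hlap.1.aestronglyMeasurable) ?_
    refine Eventually.of_forall fun v => ?_
    rw [Real.norm_eq_abs, abs_mul, abs_of_nonneg (hW0 v)]
    have h2 : |g v| ≤ ℓ * |v| + |g 0| := by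
      have h3 := hg v 0
      rw [sub_zero] at h3
      have h4 := abs_sub_abs_le_abs_sub (g v) (g 0)
      linarith
    have := mul_le_mul_of_nonneg_right h2 (hW0 v)
    linarith
  have hMi0 : 0 ≤ ∫ v, |v| * W v := integral_nonneg fun v => mul_nonneg (abs_nonneg _) (hW0 v)
  refine ⟨(∫ v, |v| * W v) / N, by positivity, ?_, ?_⟩
  · rw [div_mul_eq_mul_div, div_le_iff₀ hN]; exact hmv
  · intro m hm
    have hmN : m * N = ∫ v, g v * W v := by rw [hm, div_mul_cancel₀ _ hN.ne']
    have hz : ∀ a : ℝ, ∫ v, W v * (g v - a) = m * N - a * N := by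
      intro a
      have : ∀ v, W v * (g v - a) = g v * W v - a * W v := fun v => by ring
      simp only [this]
      rw [integral_sub hgi (hlap.1.const_mul a), integral_const_mul, hlap.2, hmN]
    have hi : ∀ a : ℝ, Integrable (fun v => W v * (g v - a)) := by
      intro a
      refine (hgi.sub (hlap.1.const_mul a)).congr (Eventually.of_forall fun v => ?_)
      simp only [Pi.sub_apply]
      ring
    refine ⟨fun u => ?_, hi m, by rw [hz]; ring⟩
    have h1 : (g u - m) * N = -∫ v, W v * (g v - g u) := by rw [hz]; ring
    have h2 : |∫ v, W v * (g v - g u)| ≤ ∫ v, ℓ * (|u| * W v + |v| * W v) := by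
      rw [← Real.norm_eq_abs]
      refine norm_integral_le_of_norm_le (((hlap.1.const_mul |u|).add hmi).const_mul ℓ) ?_
      refine Eventually.of_forall fun v => ?_
      rw [Real.norm_eq_abs, abs_mul, abs_of_nonneg (hW0 v)]
      have h3 : |g v - g u| ≤ ℓ * (|u| + |v|) := by
        refine (hg v u).trans ?_
        refine mul_le_mul_of_nonneg_left ?_ hl
        have := abs_sub v u
        linarith
      have := mul_le_mul_of_nonneg_left h3 (hW0 v)
      linarith
    rw [integral_const_mul, integral_add (hlap.1.const_mul |u|) hmi, integral_const_mul,
      hlap.2] at h2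
    have h4 : |g u - m| * N ≤ ℓ * (|u| * N + ∫ v, |v| * W v) := by
      rw [← abs_of_pos hN, ← abs_mul, h1, abs_neg, abs_of_pos hN]
      exact h2
    rw [← le_div_iff₀ hN] at h4
    refine h4.trans (le_of_eq ?_)
    field_simp

lemma piece1 {r α b z : ℝ} (hα : 0 < α) (hz : 0 < z) (g : ℝ → ℝ) :
    ∫ t in (0:ℝ)..z, Real.exp (b * α * t) * |t| ^ ((r - 1) / 2) *
      besselI ((r - 1) / 2) (α * |t|) * g t =
    α ^ (-((r - 1) / 2)) * α⁻¹ *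
      ∫ u in (0:ℝ)..(α * z), Real.exp (b * u) * u ^ (r - 1) * ii ((r - 1) / 2) u * g (u / α) := by
  have h := intervalIntegral.integral_comp_mul_left (a := 0) (b := z) (c := α)
    (fun u => Real.exp (b * u) * u ^ (r - 1) * ii ((r - 1) / 2) u * g (u / α)) hα.ne'
  rw [mul_zero, smul_eq_mul] at h
  rw [mul_assoc, ← h, ← intervalIntegral.integral_const_mul]
  refine intervalIntegral.integral_congr_ae (Eventually.of_forall fun t ht => ?_)
  rw [Set.uIoc_of_le hz.le] at ht
  have ht0 := ht.1
  rw [abs_of_pos ht0, besselI_eq _ (by positivity), mul_div_cancel_left₀ _ hα.ne',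
    show (α * t) ^ (r - 1) = (α * t) ^ ((r - 1) / 2) * (α ^ ((r - 1) / 2) * t ^ ((r - 1) / 2)) by
      rw [← Real.mul_rpow hα.le ht0.le, ← Real.rpow_add (by positivity)]; congr 1; ring,
    Real.rpow_neg hα.le, mul_assoc b α t]
  have : 0 < α ^ ((r - 1) / 2) := Real.rpow_pos_of_pos hα _
  field_simp

lemma piece2 {r α b z : ℝ} (hα : 0 < α) (hz : 0 ≤ z) (g : ℝ → ℝ) :
    ∫ t in Set.Ioi z, Real.exp (b * α * t) * |t| ^ ((r - 1) / 2) *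
      besselK ((r - 1) / 2) (α * |t|) * g t =
    α ^ (-((r - 1) / 2)) * α⁻¹ *
      ∫ u in Set.Ioi (α * z), Real.exp (b * u) * kk ((r - 1) / 2) u * g (u / α) := by
  have h := integral_comp_mul_left_Ioi
    (fun u => Real.exp (b * u) * kk ((r - 1) / 2) u * g (u / α)) z hα
  rw [smul_eq_mul] at h
  rw [mul_assoc, ← h, ← integral_const_mul]
  refine setIntegral_congr_fun measurableSet_Ioi (fun t ht => ?_)
  have ht0 : 0 < t := lt_of_le_of_lt hz ht
  rw [abs_of_pos ht0, kk_eq _ (by positivity : 0 < α * t), mul_div_cancel_left₀ _ hα.ne',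
    Real.mul_rpow hα.le ht0.le, Real.rpow_neg hα.le, mul_assoc b α t]
  have : 0 < α ^ ((r - 1) / 2) := Real.rpow_pos_of_pos hα _
  field_simp

lemma assemble {r α b z s : ℝ} (hα : 0 < α) (hz : 0 < z) (hs : 0 < s) (g : ℝ → ℝ) :
    Real.exp (-(b * α) * z) * besselK ((r - 1) / 2) (α * z) / (s * z ^ ((r - 1) / 2)) *
      (∫ t in (0:ℝ)..z, Real.exp (b * α * t) * |t| ^ ((r - 1) / 2) *
        besselI ((r - 1) / 2) (α * |t|) * g t) +
    Real.exp (-(b * α) * z) * besselI ((r - 1) / 2) (α * z) / (s * z ^ ((r - 1) / 2)) *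
      (∫ t in Set.Ioi z, Real.exp (b * α * t) * |t| ^ ((r - 1) / 2) *
        besselK ((r - 1) / 2) (α * |t|) * g t) =
    1 / (s * α) * Phi r (kk ((r - 1) / 2)) (ii ((r - 1) / 2)) b (fun u => g (u / α)) (α * z) := by
  rw [piece1 hα hz, piece2 hα hz.le, besselI_eq _ (by positivity)]
  unfold Phi
  rw [kk_eq _ (by positivity : 0 < α * z)]
  rw [show (α * z) ^ (1 - r) = ((α * z) ^ ((r - 1) / 2))⁻¹ * ((α * z) ^ ((r - 1) / 2))⁻¹ by
    rw [← Real.rpow_neg (by positivity), ← Real.rpow_add (by positivity)]; congr 1; ring,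
    Real.mul_rpow hα.le hz.le, Real.rpow_neg hα.le, show -(b * α) * z = -b * (α * z) by ring]
  have : 0 < α ^ ((r - 1) / 2) := Real.rpow_pos_of_pos hα _
  have : 0 < z ^ ((r - 1) / 2) := Real.rpow_pos_of_pos hz _
  field_simp


section VGfinal

/-- parameters: `ρ = √(θ²+σ²)`. -/
lemma vg_density_eq {r θ σ : ℝ} (hr : 0 < r) (hσ : 0 < σ) {t : ℝ} (ht : t ≠ 0) :
    vgDensity r θ σ t =
      Real.sqrt (θ ^ 2 + σ ^ 2) / σ ^ 2 / NN ((r - 1) / 2) (θ / Real.sqrt (θ ^ 2 + σ ^ 2)) *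
      (Real.exp (θ / Real.sqrt (θ ^ 2 + σ ^ 2) * (Real.sqrt (θ ^ 2 + σ ^ 2) / σ ^ 2 * t)) *
        kk ((r - 1) / 2) (Real.sqrt (θ ^ 2 + σ ^ 2) / σ ^ 2 * t)) := by
  have hρ2 : Real.sqrt (θ ^ 2 + σ ^ 2) ^ 2 = θ ^ 2 + σ ^ 2 := Real.sq_sqrt (by positivity)
  have hρ : 0 < Real.sqrt (θ ^ 2 + σ ^ 2) := Real.sqrt_pos.2 (by positivity)
  unfold vgDensity NN
  set ρ := Real.sqrt (θ ^ 2 + σ ^ 2) with hρd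
  have hG : 0 < Real.Gamma (r / 2) := Real.Gamma_pos_of_pos (by linarith)
  have ht0 : 0 < |t| := abs_pos.2 ht
  have hπ : 0 < Real.sqrt Real.pi := Real.sqrt_pos.2 Real.pi_pos
  have e1 : kk ((r - 1) / 2) (ρ / σ ^ 2 * t) =
      (ρ / σ ^ 2 * |t|) ^ ((r - 1) / 2) * besselK ((r - 1) / 2) (ρ * |t| / σ ^ 2) := by
    rw [← kk_abs, abs_mul, abs_of_pos (by positivity : 0 < ρ / σ ^ 2), kk_eq _ (by positivity)]
    congr 2; ring
  have e2 : θ / ρ * (ρ / σ ^ 2 * t) = θ * t / σ ^ 2 := by field_simp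
  have e3 : 2 / (1 - (θ / ρ) ^ 2) = 2 * ρ * (ρ / σ ^ 2) := by
    have : 1 - (θ / ρ) ^ 2 = σ ^ 2 / ρ ^ 2 := by
      field_simp; rw [hρ2]; ring
    rw [this]; field_simp
  have e4 : (2 * ρ * (ρ / σ ^ 2)) ^ ((r - 1) / 2 + 1 / 2) =
      (2 * ρ * (ρ / σ ^ 2)) ^ ((r - 1) / 2) * (Real.sqrt 2 * (ρ / σ)) := by
    rw [Real.rpow_add (by positivity)]
    congr 1
    rw [← Real.sqrt_eq_rpow, show 2 * ρ * (ρ / σ ^ 2) = 2 * (ρ / σ) ^ 2 by field_simp,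
      Real.sqrt_mul (by norm_num), Real.sqrt_sq (by positivity)]
  have e5 : (ρ / σ ^ 2 * |t|) ^ ((r - 1) / 2) =
      (|t| / (2 * ρ)) ^ ((r - 1) / 2) * (2 * ρ * (ρ / σ ^ 2)) ^ ((r - 1) / 2) := by
    rw [← Real.mul_rpow (by positivity) (by positivity)]
    congr 1; field_simp
  rw [e1, e2, e3, e4, e5, show (r - 1) / 2 + 1 / 2 = r / 2 by ring, Real.sqrt_mul (by norm_num)]
  have h2 : Real.sqrt 2 * Real.sqrt 2 = 2 := Real.mul_self_sqrt (by norm_num)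
  have h20 : 0 < Real.sqrt 2 := by positivity
  have p1 : 0 < (2 * ρ * (ρ / σ ^ 2)) ^ ((r - 1) / 2) := by positivity
  generalize (2 * ρ * (ρ / σ ^ 2)) ^ ((r - 1) / 2) = P at *
  generalize (|t| / (2 * ρ)) ^ ((r - 1) / 2) = Q at *
  generalize besselK ((r - 1) / 2) (ρ * |t| / σ ^ 2) = KK at *
  generalize Real.Gamma (r / 2) = g at *
  generalize Real.exp (θ * t / σ ^ 2) = E at *
  field_simp
  linear_combination (E * Q * KK) * h2

lemma Cconst_ge {r θ σ : ℝ} (hr : 0 < r) (hσ : 0 < σ) :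
    6 + 2 * Real.sqrt (2 * Real.pi * (r + 1)) *
      (|θ / Real.sqrt (θ ^ 2 + σ ^ 2)| * (1 - (θ / Real.sqrt (θ ^ 2 + σ ^ 2)) ^ 2) ^ (-(r / 2))) +
      2 * (Real.sqrt (2 * r) + r) * A0 r (θ / Real.sqrt (θ ^ 2 + σ ^ 2)) ≤ Cconst r θ σ := by
  have hρ2 : Real.sqrt (θ ^ 2 + σ ^ 2) ^ 2 = θ ^ 2 + σ ^ 2 := Real.sq_sqrt (by positivity)
  have hρ : 0 < Real.sqrt (θ ^ 2 + σ ^ 2) := Real.sqrt_pos.2 (by positivity)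
  unfold Cconst Aconst A0
  set ρ := Real.sqrt (θ ^ 2 + σ ^ 2) with hρd
  have e0 : 1 - (θ / ρ) ^ 2 = (1 + θ ^ 2 / σ ^ 2)⁻¹ := by
    have h1 : 1 + θ ^ 2 / σ ^ 2 = ρ ^ 2 / σ ^ 2 := by rw [hρ2]; field_simp; ring
    rw [h1, inv_div]
    field_simp
    rw [hρ2]; ring
  have e0' : (1 + θ ^ 2 / σ ^ 2) = (ρ / σ) ^ 2 := by rw [div_pow, hρ2]; field_simp; ring
  have hpos : 0 < 1 + θ ^ 2 / σ ^ 2 := by positivity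
  have e1 : (1 - (θ / ρ) ^ 2) ^ (-(r / 2)) = (1 + θ ^ 2 / σ ^ 2) ^ (r / 2) := by
    rw [e0, Real.inv_rpow hpos.le, Real.rpow_neg hpos.le, inv_inv]
  have e2 : |θ / ρ| * (1 + θ ^ 2 / σ ^ 2) ^ (r / 2) =
      |θ| / σ * (1 + θ ^ 2 / σ ^ 2) ^ ((r - 1) / 2) := by
    rw [show r / 2 = (r - 1) / 2 + 1 / 2 by ring, Real.rpow_add hpos, ← Real.sqrt_eq_rpow]
    have : Real.sqrt (1 + θ ^ 2 / σ ^ 2) = ρ / σ := by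
      rw [e0', Real.sqrt_sq (by positivity)]
    rw [this, abs_div, abs_of_pos hρ]
    field_simp
  have e3 : 12 * Real.Gamma (r / 2) / (1 - (θ / ρ) ^ 2) =
      12 * Real.Gamma (r / 2) * (1 + θ ^ 2 / σ ^ 2) := by rw [e0, div_inv_eq_mul]
  rw [e3, e1, e2]
  have h0 : 0 ≤ 2 * Real.sqrt 2 / Real.sqrt r := by positivity
  rw [← mul_assoc (2 * Real.sqrt (2 * Real.pi * (r + 1)))]
  linarith

end VGfinal

theorem stein_factor_f'_lipschitz (r θ σ : ℝ) (hr : 0 < r) (hσ : 0 < σ)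
    (h : ℝ → ℝ) (L : ℝ) (hL : 0 ≤ L) (hlip : ∀ u v : ℝ, |h u - h v| ≤ L * |u - v|) :
    ∀ x : ℝ, x ≠ 0 → ∀ d : ℝ, HasDerivAt (steinSolution r θ σ h) d x →
      |d| ≤ (Real.sqrt (θ ^ 2 + σ ^ 2) / σ ^ 2) * Cconst r θ σ * L := by
  intro x hx d hd
  have hC := Cconst_ge (θ := θ) hr hσ
  have hdens := fun t ht => vg_density_eq (r := r) (θ := θ) (σ := σ) hr hσ (t := t) ht
  have hρ2 : Real.sqrt (θ ^ 2 + σ ^ 2) ^ 2 = θ ^ 2 + σ ^ 2 := Real.sq_sqrt (by positivity)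
  have hρ : 0 < Real.sqrt (θ ^ 2 + σ ^ 2) := Real.sqrt_pos.2 (by positivity)
  have hst : ∀ x, steinSolution r θ σ h x =
  -(Real.exp (-(θ / σ ^ 2) * x) *
      besselK ((r - 1) / 2) (Real.sqrt (θ ^ 2 + σ ^ 2) / σ ^ 2 * |x|) /
      (σ ^ 2 * |x| ^ ((r - 1) / 2))) *
    (∫ t in (0:ℝ)..x, Real.exp ((θ / σ ^ 2) * t) * |t| ^ ((r - 1) / 2) *
      besselI ((r - 1) / 2) (Real.sqrt (θ ^ 2 + σ ^ 2) / σ ^ 2 * |t|) * htilde r θ σ h t) -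
  (Real.exp (-(θ / σ ^ 2) * x) *
      besselI ((r - 1) / 2) (Real.sqrt (θ ^ 2 + σ ^ 2) / σ ^ 2 * |x|) /
      (σ ^ 2 * |x| ^ ((r - 1) / 2))) *
    (∫ t in Set.Ioi x, Real.exp ((θ / σ ^ 2) * t) * |t| ^ ((r - 1) / 2) *
      besselK ((r - 1) / 2) (Real.sqrt (θ ^ 2 + σ ^ 2) / σ ^ 2 * |t|) * htilde r θ σ h t) := fun x => rfl
  set ρ := Real.sqrt (θ ^ 2 + σ ^ 2) with hρd
  set α := ρ / σ ^ 2 with hαd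
  set b := θ / ρ with hbd
  have hα : 0 < α := by positivity
  have hbα : θ / σ ^ 2 = b * α := by rw [hbd, hαd]; field_simp
  have hσ2 : 0 < σ ^ 2 := by positivity
  have hb : |b| < 1 := by
    rw [hbd, abs_div, abs_of_pos hρ, div_lt_one hρ]
    rw [← Real.sqrt_sq_eq_abs]
    exact Real.sqrt_lt_sqrt (sq_nonneg _) (by linarith)
  have hq := q_pos hb
  have hqα : σ ^ 2 * α ^ 2 * (1 - b ^ 2) = 1 := by
    rw [hαd, hbd]
    field_simp
    rw [hρ2]; ring
  have hN := NN_pos hr hb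
  -- centring
  have hl : 0 ≤ L / α := by positivity
  have hglip : ∀ u v : ℝ, |h (u / α) - h (v / α)| ≤ L / α * |u - v| := by
    intro u v
    refine (hlip _ _).trans (le_of_eq ?_)
    rw [← sub_div, abs_div, abs_of_pos hα]; ring
  obtain ⟨M, hM0, hM2, hcen⟩ := centre hr hb (g := fun u => h (u / α)) hl hglip
  set m := ∫ t, h t * vgDensity r θ σ t with hm
  have hm2 : m = (∫ v, h (v / α) * (Real.exp (b * v) * kk ((r - 1) / 2) v)) /
      NN ((r - 1) / 2) b := by
    have h1 := Measure.integral_comp_mul_left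
      (fun v => h (v / α) * (Real.exp (b * v) * kk ((r - 1) / 2) v)) α
    rw [abs_of_pos (inv_pos.2 hα), smul_eq_mul] at h1
    have h2 : m = ∫ t, α / NN ((r - 1) / 2) b * (h (α * t / α) * (Real.exp (b * (α * t)) *
        kk ((r - 1) / 2) (α * t))) := by
      rw [hm]
      refine integral_congr_ae ?_
      have : ∀ᵐ t : ℝ, t ≠ 0 := by
        simp [ae_iff]
      filter_upwards [this] with t ht
      rw [hdens t ht, mul_div_cancel_left₀ _ hα.ne']
      ring
    rw [h2, integral_const_mul, h1]
    generalize (∫ v, h (v / α) * (Real.exp (b * v) * kk ((r - 1) / 2) v)) = I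
    field_simp
  obtain ⟨hHb, hHi, hH0⟩ := hcen m hm2
  have hht : ∀ t, htilde r θ σ h t = h t - m := fun t => rfl
  simp only [hht, hbα] at hst
  have hgc : Continuous (fun u => h (u / α) - m) := by
    have : LipschitzWith ⟨L / α, hl⟩ (fun u => h (u / α)) := by
      refine LipschitzWith.of_dist_le_mul fun x y => ?_
      rw [Real.dist_eq, Real.dist_eq]; exact hglip x y
    exact this.continuous.sub continuous_const
  have B := bsys hr
  -- final numeric step
  have hfin : ∀ e : ℝ, |e| ≤ L / α * (Cconst r θ σ / (1 - b ^ 2)) → |d| = |e| / σ ^ 2 →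
      |d| ≤ α * Cconst r θ σ * L := by
    intro e he hde
    rw [hde, div_le_iff₀ hσ2]
    refine he.trans (le_of_eq ?_)
    have : L / α * (Cconst r θ σ / (1 - b ^ 2)) =
      L * Cconst r θ σ / (α * (1 - b ^ 2)) := by field_simp
    rw [this, div_eq_iff (by positivity)]
    linear_combination (-(L * Cconst r θ σ)) * hqα
  rcases lt_or_gt_of_ne hx with hneg | hpos
  · -- x < 0
    have hb' : |-b| < 1 := by rwa [abs_neg]
    have hgc' : Continuous (fun u => h (-(u / α)) - m) := by
      have := hgc.comp continuous_neg
      simpa only [Function.comp_def, neg_div] using this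
    have hHb' : ∀ t, |h (-(t / α)) - m| ≤ L / α * (|t| + M) := by
      intro t
      have := hHb (-t)
      rwa [neg_div, abs_neg t] at this
    have hαx : 0 < α * (-x) := mul_pos hα (by linarith)
    have hP := B.Phi_deriv hb' hgc' hHb' hαx
    set e := -BSys.Pd r (kk ((r - 1) / 2)) (kk ((r - 1) / 2 + 1)) (-b) (α * -x) *
      (∫ t in (0:ℝ)..(α * -x), Real.exp (-b * t) * t ^ (r - 1) * ii ((r - 1) / 2) t *
        (h (-(t / α)) - m)) + BSys.Qd (ii ((r - 1) / 2)) (ii ((r - 1) / 2 + 1)) (-b) (α * -x) *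
      (∫ t in Set.Ioi (α * -x), Real.exp (-b * t) * kk ((r - 1) / 2) t * (h (-(t / α)) - m)) with he
    have hbd2 := B.Phi_deriv_bound hb' hgc' hl hM0 (by rwa [neg_sq]) hHb' hαx hP
    have hA : A0 r (-b) = A0 r b := by unfold A0; rw [neg_sq]
    rw [neg_sq, abs_neg b, hA] at hbd2
    have hcomp : HasDerivAt (fun y : ℝ => 1 / (σ ^ 2 * α) *
        Phi r (kk ((r - 1) / 2)) (ii ((r - 1) / 2)) (-b) (fun u => h (-(u / α)) - m) (α * -y))
        (1 / (σ ^ 2 * α) * (e * (α * -1))) x := by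
      have h1 : HasDerivAt (fun y : ℝ => α * -y) (α * -1) x := ((hasDerivAt_id x).neg).const_mul α
      exact (HasDerivAt.comp x hP h1).const_mul _
    -- the zero-mean identity in the original variable
    obtain ⟨w, hw⟩ : ∃ w : ℝ → ℝ, w = fun t => Real.exp (b * α * t) * |t| ^ ((r - 1) / 2) *
      besselK ((r - 1) / 2) (α * |t|) * (h t - m) := ⟨_, rfl⟩
    have hwe : ∀ t, t ≠ 0 → w t = α ^ (-((r - 1) / 2)) *
        (Real.exp (b * (α * t)) * kk ((r - 1) / 2) (α * t) * (h (α * t / α) - m)) := by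
      intro t ht
      have ht0 : 0 < |t| := abs_pos.2 ht
      simp only [hw]
      rw [← kk_abs _ (α * t), abs_mul, abs_of_pos hα, kk_eq _ (by positivity : 0 < α * |t|),
        mul_div_cancel_left₀ _ hα.ne', Real.mul_rpow hα.le ht0.le, Real.rpow_neg hα.le,
        mul_assoc b α t]
      have : 0 < α ^ ((r - 1) / 2) := Real.rpow_pos_of_pos hα _
      field_simp
    have hae : ∀ᵐ t : ℝ, t ≠ 0 := by simp [ae_iff]
    have hwi : Integrable w := by
      refine (((hHi.comp_mul_left' hα.ne')).const_mul (α ^ (-((r - 1) / 2)))).congr ?_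
      filter_upwards [hae] with t ht
      rw [hwe t ht]
    have hw0 : ∫ t, w t = 0 := by
      have h1 := Measure.integral_comp_mul_left
        (fun v => Real.exp (b * v) * kk ((r - 1) / 2) v * (h (v / α) - m)) α
      rw [hH0, smul_zero] at h1
      have h2 : ∫ t, w t = ∫ t, α ^ (-((r - 1) / 2)) *
        (Real.exp (b * (α * t)) * kk ((r - 1) / 2) (α * t) * (h (α * t / α) - m)) := by
        refine integral_congr_ae ?_
        filter_upwards [hae] with t ht
        rw [hwe t ht]
      rw [h2, integral_const_mul, h1, mul_zero]
    have heq : steinSolution r θ σ h =ᶠ[nhds x] (fun y : ℝ => 1 / (σ ^ 2 * α) *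
        Phi r (kk ((r - 1) / 2)) (ii ((r - 1) / 2)) (-b) (fun u => h (-(u / α)) - m) (α * -y)) := by
      filter_upwards [Iio_mem_nhds hneg] with y hy
      have hy : y < 0 := hy
      have hz : 0 < -y := by linarith
      rw [← assemble (s := σ ^ 2) hα hz hσ2 (fun t => h (-t) - m), hst y]
      have i1 : ∫ t in (0:ℝ)..y, Real.exp (b * α * t) * |t| ^ ((r - 1) / 2) *
          besselI ((r - 1) / 2) (α * |t|) * (h t - m) =
          -∫ t in (0:ℝ)..(-y), Real.exp (-b * α * t) * |t| ^ ((r - 1) / 2) *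
          besselI ((r - 1) / 2) (α * |t|) * (h (-t) - m) := by
        have h1 := intervalIntegral.integral_comp_neg (a := 0) (b := -y)
          (fun t => Real.exp (b * α * t) * |t| ^ ((r - 1) / 2) *
          besselI ((r - 1) / 2) (α * |t|) * (h t - m))
        rw [neg_neg, neg_zero] at h1
        simp only [abs_neg] at h1
        rw [intervalIntegral.integral_symm y 0, ← h1]
        congr 1
        refine intervalIntegral.integral_congr (fun t _ => ?_)
        rw [show b * α * -t = -b * α * t by ring]
      have i2 : ∫ t in Set.Ioi y, w t =
          -∫ t in Set.Ioi (-y), Real.exp (-b * α * t) * |t| ^ ((r - 1) / 2) *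
          besselK ((r - 1) / 2) (α * |t|) * (h (-t) - m) := by
        have h1 := integral_comp_neg_Ioi (-y) w
        rw [neg_neg] at h1
        have h2 := intervalIntegral.integral_Iic_add_Ioi (b := y) hwi.integrableOn hwi.integrableOn
        rw [hw0, ← h1] at h2
        have h3 : ∫ t in Set.Ioi (-y), w (-t) = ∫ t in Set.Ioi (-y),
          Real.exp (-b * α * t) * |t| ^ ((r - 1) / 2) *
          besselK ((r - 1) / 2) (α * |t|) * (h (-t) - m) := by
          refine setIntegral_congr_fun measurableSet_Ioi (fun t _ => ?_)
          simp only [hw, abs_neg]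
          rw [show b * α * -t = -b * α * t by ring]
        linarith
      simp only [hw] at i2
      rw [i1, i2, abs_of_neg hy, show -(-b * α) * -y = -(b * α) * y by ring]
      ring
    have hu := hd.unique (hcomp.congr_of_eventuallyEq heq)
    refine hfin e ?_ ?_
    · refine hbd2.trans ?_
      gcongr
    · rw [hu, show 1 / (σ ^ 2 * α) * (e * (α * -1)) = -(e / σ ^ 2) by field_simp, abs_neg, abs_div,
        abs_of_pos hσ2]
  · -- x > 0
    have hpos : 0 < x := hpos
    have hαx : 0 < α * x := mul_pos hα hpos
    have hP := B.Phi_deriv hb hgc hHb hαx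
    set e := -BSys.Pd r (kk ((r - 1) / 2)) (kk ((r - 1) / 2 + 1)) b (α * x) *
      (∫ t in (0:ℝ)..(α * x), Real.exp (b * t) * t ^ (r - 1) * ii ((r - 1) / 2) t *
        (h (t / α) - m)) + BSys.Qd (ii ((r - 1) / 2)) (ii ((r - 1) / 2 + 1)) b (α * x) *
      (∫ t in Set.Ioi (α * x), Real.exp (b * t) * kk ((r - 1) / 2) t * (h (t / α) - m)) with he
    have hbd2 := B.Phi_deriv_bound hb hgc hl hM0 hM2 hHb hαx hP
    have hcomp : HasDerivAt (fun y : ℝ => -(1 / (σ ^ 2 * α) *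
        Phi r (kk ((r - 1) / 2)) (ii ((r - 1) / 2)) b (fun u => h (u / α) - m) (α * y)))
        (-(1 / (σ ^ 2 * α) * (e * (α * 1)))) x := by
      have h1 : HasDerivAt (fun y : ℝ => α * y) (α * 1) x := (hasDerivAt_id x).const_mul α
      exact ((HasDerivAt.comp x hP h1).const_mul _).neg
    have heq : steinSolution r θ σ h =ᶠ[nhds x] (fun y : ℝ => -(1 / (σ ^ 2 * α) *
        Phi r (kk ((r - 1) / 2)) (ii ((r - 1) / 2)) b (fun u => h (u / α) - m) (α * y))) := by
      filter_upwards [Ioi_mem_nhds hpos] with y hy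
      have hy : 0 < y := hy
      rw [← assemble (s := σ ^ 2) hα hy hσ2 (fun t => h t - m), hst y, abs_of_pos hy]
      ring
    have hu := hd.unique (hcomp.congr_of_eventuallyEq heq)
    refine hfin e ?_ ?_
    · refine hbd2.trans ?_
      gcongr
    · rw [hu, show -(1 / (σ ^ 2 * α) * (e * (α * 1))) = -(e / σ ^ 2) by field_simp, abs_neg, abs_div,
        abs_of_pos hσ2]
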